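/- Assume hypothesis (****) and that both K and L have supporting spheres at all of their boundary points (for S^d of radii less than π/2). Then each of conditions (5) and (6) of Theorem 7 implies that both K and L are C¹ (have smooth boundaries). -/

import Mathlib

open Metric Set Filter

namespace BallChar

/-- `X` is (isometric to) the `d`-dimensional round sphere of radius 1,
with the intrinsic (great-circle) metric. -/
def IsSphereSpace (X : Type*) [MetricSpace X] (d : ℕ) : Prop :=
  ∃ e : X → EuclideanSpace ℝ (Fin (d + 1)),
    Function.Injective e ∧
    Set.range e = Metric.sphere (0 : EuclideanSpace ℝ (Fin (d + 1))) 1 ∧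
    ∀ x y : X, dist x y = Real.arccos (@inner ℝ _ _ (e x) (e y))

/-- `X` is (isometric to) the `d`-dimensional Euclidean space. -/
def IsEuclideanSpaceForm (X : Type*) [MetricSpace X] (d : ℕ) : Prop :=
  Nonempty (X ≃ᵢ EuclideanSpace ℝ (Fin d))

/-- The Minkowski bilinear form on `ℝ^d × ℝ`. -/
noncomputable def mink (d : ℕ) (u v : EuclideanSpace ℝ (Fin d) × ℝ) : ℝ :=
  @inner ℝ _ _ u.1 v.1 - u.2 * v.2

/-- `X` is (isometric to) the `d`-dimensional hyperbolic space of curvature `-1`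
(the hyperboloid model). -/
def IsHyperbolicSpace (X : Type*) [MetricSpace X] (d : ℕ) : Prop :=
  ∃ e : X → EuclideanSpace ℝ (Fin d) × ℝ,
    Function.Injective e ∧
    Set.range e = {u | mink d u u = -1 ∧ 0 < u.2} ∧
    ∀ x y : X, Real.cosh (dist x y) = - mink d (e x) (e y)

/-- `X` is `S^d`, `ℝ^d` or `H^d`. -/
def IsSpaceForm (X : Type*) [MetricSpace X] (d : ℕ) : Prop :=
  IsSphereSpace X d ∨ IsEuclideanSpaceForm X d ∨ IsHyperbolicSpace X d

variable {X : Type*} [MetricSpace X]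

/-- Metric betweenness: `z` lies on a shortest geodesic from `x` to `y`. -/
def Btw (x z y : X) : Prop := dist x z + dist z y = dist x y

/-- `z` is the unique point between `x` and `y` at its distance from `x`. -/
def UniqueBtwPt (x z y : X) : Prop :=
  Btw x z y ∧ ∀ w, Btw x w y → dist x w = dist x z → w = z

/-- Geodesic convexity (for two antipodal points of a sphere no condition is imposed). -/
def GConvex (K : Set X) : Prop :=
  ∀ x ∈ K, ∀ y ∈ K, ∀ z, UniqueBtwPt x z y → z ∈ K

/-- `p` is a (metric) midpoint of `x` and `y`. -/
def IsMidpoint (p x y : X) : Prop := Btw x p y ∧ dist x p = dist p y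

/-- A reflection in a hyperplane: a non-trivial involutive isometry whose
non-fixed locus is disconnected (by the mirror hyperplane). -/
def IsReflection (σ : X ≃ᵢ X) : Prop :=
  σ.trans σ = IsometryEquiv.refl X ∧ σ ≠ IsometryEquiv.refl X ∧
    ¬ IsPreconnected {x : X | σ x ≠ x}

/-- An orientation preserving congruence: a product of an even number of reflections. -/
def OrientationPreserving (f : X ≃ᵢ X) : Prop :=
  ∃ l : List (X ≃ᵢ X), (∀ σ ∈ l, IsReflection σ) ∧ Even l.length ∧
    f = l.foldr IsometryEquiv.trans (IsometryEquiv.refl X)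

/-- Two subsets are congruent if some isometry of the space maps one onto the other. -/
def Congruent (A B : Set X) : Prop := ∃ f : X ≃ᵢ X, ⇑f '' A = B

/-- `S` admits some non-trivial congruence. -/
def AdmitsNontrivialCongruence (S : Set X) : Prop :=
  ∃ f : X ≃ᵢ X, f ≠ IsometryEquiv.refl X ∧ ⇑f '' S = S

/-- `S` is axially symmetric (symmetric with respect to some reflection). -/
def AxiallySymmetric (S : Set X) : Prop :=
  ∃ σ : X ≃ᵢ X, IsReflection σ ∧ ⇑σ '' S = S

/-- `S` is centrally symmetric: some involutive isometry fixing a point `p`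
maps `S` onto itself, `p` being a midpoint of every pair `x`, `σ x` of `S`. -/
def CentrallySymmetric (S : Set X) : Prop :=
  ∃ (σ : X ≃ᵢ X) (p : X), Function.Involutive ⇑σ ∧ σ p = p ∧ ⇑σ '' S = S ∧
    ∀ x ∈ S, IsMidpoint p x (σ x)

/-- `S` is symmetric with respect to the orthogonal bisector hyperplane of
the segment `[a, b]`, i.e. invariant under the reflection interchanging `a` and `b`. -/
def SymmetricWrtPerpBisector (S : Set X) (a b : X) : Prop :=
  ∃ σ : X ≃ᵢ X, IsReflection σ ∧ σ a = b ∧ ⇑σ '' S = S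

/-- A closed half-space: one of the two closed sides of the mirror of a reflection. -/
def IsHalfspace (P : Set X) : Prop :=
  ∃ σ : X ≃ᵢ X, IsReflection σ ∧ IsClosed P ∧
    P ∪ ⇑σ '' P = univ ∧ P ∩ ⇑σ '' P = {x | σ x = x}

/-- A hyperplane: the mirror (fixed point set) of a reflection. -/
def IsHyperplane (B : Set X) : Prop :=
  ∃ σ : X ≃ᵢ X, IsReflection σ ∧ B = {x | σ x = x}

/-- A paraball (horoball): a sublevel set of a Busemann function. -/
def IsParaball (K : Set X) : Prop :=
  ∃ γ : ℝ → X, Isometry γ ∧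
    K = {x | ∃ b ≤ 0, Tendsto (fun t => dist x (γ t) - t) atTop (nhds b)}

/-- A parasphere (horosphere): the boundary of a paraball. -/
def IsParasphere (C : Set X) : Prop := ∃ K : Set X, IsParaball K ∧ C = frontier K

/-- A hypersphere at distance `lam > 0` from its base hyperplane
(degeneration to a hyperplane excluded). -/
def IsHypersphere (C : Set X) (lam : ℝ) : Prop :=
  0 < lam ∧ (∃ P : Set X, IsHalfspace P ∧ C = frontier {x | infDist x P ≤ lam}) ∧
    ¬ IsHyperplane C

/-- The family of connected components of the boundary of `K`. -/
def bdryComponents (K : Set X) : Set (Set X) :=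
  (connectedComponentIn (frontier K)) '' (frontier K)

/-- `closedBall p r` is an inball of `M` (a ball of maximal radius contained in `M`). -/
def IsInball (M : Set X) (p : X) (r : ℝ) : Prop :=
  0 ≤ r ∧ closedBall p r ⊆ M ∧ ∀ (q : X) (s : ℝ), closedBall q s ⊆ M → s ≤ r

/-- `closedBall p r` is the unique inball of `M`. -/
def HasUniqueInball (M : Set X) (p : X) (r : ℝ) : Prop :=
  IsInball M p r ∧ ∀ (q : X) (s : ℝ), IsInball M q s → q = p

/-- The (geodesic) convex hull of a set. -/
def gconvexHull (Y : Set X) : Set X := ⋂₀ {C : Set X | GConvex C ∧ Y ⊆ C}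

/-- `z` lies on the complete geodesic line through `a` and `b`. -/
def OnLine (a b z : X) : Prop := Btw a z b ∨ Btw z a b ∨ Btw a b z

/-- The closed `(d-1)`-ball of radius `ε` centred at `a` in the hyperplane through `a`
orthogonal to the segment `[a, b]`. -/
def perpDisc (a b : X) (ε : ℝ) : Set X :=
  {x | (∀ z, OnLine a b z → dist x a ≤ dist x z) ∧ dist x a ≤ ε}

/-- The set `D(ε)` associated to the segment `D = [a, b]`: the convex hull of the two
`(d-1)`-balls of radius `ε` orthogonal to `D` at its endpoints. -/
def segCyl (a b : X) (ε : ℝ) : Set X :=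
  gconvexHull (perpDisc a b ε ∪ perpDisc b a ε)

/-- `[a, b]` is the unique diametral segment of `M`. -/
def UniqueDiametral (M : Set X) (a b : X) : Prop :=
  a ∈ M ∧ b ∈ M ∧ a ≠ b ∧ dist a b = diam M ∧
    ∀ a' ∈ M, ∀ b' ∈ M, dist a' b' = diam M → (a' = a ∧ b' = b) ∨ (a' = b ∧ b' = a)

/-- Condition (**): at every boundary point, `K` contains a ball having this point
on its boundary. -/
def CondBallInside (K : Set X) : Prop :=
  ∀ x ∈ frontier K, ∃ ε > 0, ∃ p : X, closedBall p ε ⊆ K ∧ x ∈ sphere p ε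

/-- `K` has an extreme point. -/
def HasExtremePoint (K : Set X) : Prop :=
  ∃ x ∈ K, ∀ y ∈ K, ∀ z ∈ K, Btw y x z → x = y ∨ x = z

/-- Condition (***): near every boundary point, `K` is contained in a ball
(resp. in a convex set bounded by a hypersphere, for hyperbolic space) whose boundary
has sectional curvatures bounded below and passes through the given point. -/
def CondCurvBound (d : ℕ) (K : Set X) : Prop :=
  ∀ x ∈ frontier K, ∃ ε > 0, ∃ B : Set X,
    {y | y ∈ K ∧ dist y x ≤ ε} ⊆ B ∧ x ∈ frontier B ∧
    (IsSphereSpace X d → ∃ (q : X) (R : ℝ), 0 < R ∧ R < Real.pi / 2 ∧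
        ε ≤ Real.cos R / Real.sin R ∧ B = closedBall q R) ∧
    (IsEuclideanSpaceForm X d → ∃ (q : X) (R : ℝ), 0 < R ∧ ε ≤ 1 / R ∧ B = closedBall q R) ∧
    (IsHyperbolicSpace X d → ∃ (P : Set X) (lam : ℝ), IsHalfspace P ∧ 0 < lam ∧
        ε ≤ Real.tanh lam ∧ B = {y | infDist y P ≤ lam})

/-- `K` has a supporting sphere at each of its boundary points
(for the sphere, of radius less than `π/2`). -/
def SupportingSpheres (d : ℕ) (K : Set X) : Prop :=
  ∀ x ∈ frontier K, ∃ (p : X) (R : ℝ), 0 < R ∧ K ⊆ closedBall p R ∧ x ∈ sphere p R ∧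
    (IsSphereSpace X d → R < Real.pi / 2)

/-- `K` is `C¹` (smooth): at each boundary point there is a unique supporting half-space. -/
def SmoothBody (K : Set X) : Prop :=
  ∀ x ∈ frontier K, ∃! P : Set X, IsHalfspace P ∧ K ⊆ P ∧ x ∈ frontier P

/-- A complete geodesic (straight line). -/
def IsGeodesicLine (B : Set X) : Prop := ∃ γ : ℝ → X, Isometry γ ∧ B = Set.range γ

/-- A circle (closed disc) of positive radius. -/
def IsDisc (K : Set X) : Prop := ∃ (p : X) (r : ℝ), 0 < r ∧ K = closedBall p r

/-- The parallel domain of `B` at distance `l`. -/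
def parallelDomain (B : Set X) (l : ℝ) : Set X := {x | infDist x B ≤ l}

/-- `K` is the parallel domain of some straight line, at some distance `l > 0`. -/
def IsParallelDomain (K : Set X) : Prop :=
  ∃ (B : Set X) (l : ℝ), IsGeodesicLine B ∧ 0 < l ∧ K = parallelDomain B l

/-- A convex domain bounded by a (proper) hypercycle. -/
def IsHypercycleDomain (K : Set X) : Prop :=
  ∃ (P : Set X) (l : ℝ), IsHalfspace P ∧ 0 < l ∧ K = {x | infDist x P ≤ l}

/-- `C` is a hypercycle or a straight line (a curve at constant distance `l ≥ 0`
from its base line). -/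
def IsHypercycleOrLine (C : Set X) : Prop :=
  ∃ (P : Set X) (l : ℝ), IsHalfspace P ∧ 0 ≤ l ∧ C = frontier {x | infDist x P ≤ l}

/-- `C` is a hypercycle (or straight line) with base line `B`. -/
def HypercycleWithBase (C B : Set X) : Prop :=
  ∃ (P : Set X) (l : ℝ), IsHalfspace P ∧ 0 ≤ l ∧ frontier P = B ∧
    C = frontier {x | infDist x P ≤ l}


/-! Cases (A)-(E) of Theorem 5 (hyperbolic plane). -/

/-- One of the basic bodies of case (A). -/
def CaseABody (K : Set X) : Prop :=
  IsDisc K ∨ IsParaball K ∨ IsHypercycleDomain K ∨ IsHalfspace K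

/-- Case (A) of Theorem 5. -/
def CaseA (K L : Set X) : Prop :=
  CaseABody K ∧ CaseABody L ∧
    ((IsHypercycleDomain K ∨ IsHalfspace K) → IsDisc L ∨ Congruent K L) ∧
    ((IsHypercycleDomain L ∨ IsHalfspace L) → IsDisc K ∨ Congruent L K)

/-- `M` is bounded either by two hypercycles whose base lines coincide, or by a
hypercycle and its base line. -/
def TwoHypSameBase (M : Set X) : Prop :=
  ∃ (B C₁ C₂ : Set X), IsGeodesicLine B ∧ C₁ ≠ C₂ ∧
    HypercycleWithBase C₁ B ∧ HypercycleWithBase C₂ B ∧ frontier M = C₁ ∪ C₂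

/-- Case (B) of Theorem 5. -/
def CaseB (K L : Set X) : Prop :=
  (IsDisc K ∧ TwoHypSameBase L) ∨ (IsDisc L ∧ TwoHypSameBase K)

/-- `M` is bounded by at least two hypercycles or straight lines, with all base lines
different, whose mutual distances are at least `2r`. -/
def MultiHypFarApart (M : Set X) (r : ℝ) : Prop :=
  (∀ x ∈ frontier M, IsHypercycleOrLine (connectedComponentIn (frontier M) x)) ∧
  (∃ x ∈ frontier M, ∃ y ∈ frontier M,
      connectedComponentIn (frontier M) x ≠ connectedComponentIn (frontier M) y) ∧
  (∀ x ∈ frontier M, ∀ y ∈ frontier M,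
      connectedComponentIn (frontier M) x ≠ connectedComponentIn (frontier M) y →
        2 * r ≤ dist x y ∧
        ∀ B₁ B₂ : Set X, HypercycleWithBase (connectedComponentIn (frontier M) x) B₁ →
          HypercycleWithBase (connectedComponentIn (frontier M) y) B₂ → B₁ ≠ B₂)

/-- Case (C) of Theorem 5. -/
def CaseC (K L : Set X) : Prop :=
  (∃ (p : X) (r : ℝ), 0 < r ∧ K = closedBall p r ∧ MultiHypFarApart L r) ∨
  (∃ (p : X) (r : ℝ), 0 < r ∧ L = closedBall p r ∧ MultiHypFarApart K r)

/-- Case (D) of Theorem 5. -/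
def CaseD (K L : Set X) : Prop :=
  (IsParaball K ∧ IsParallelDomain L) ∨ (IsParaball L ∧ IsParallelDomain K)

/-- Case (E) of Theorem 5. -/
def CaseE (K L : Set X) : Prop :=
  Congruent K L ∧ IsParallelDomain K ∧ IsParallelDomain L

/-- All cases of (3) of Theorem 5 together. -/
def Theorem5Cases (K L : Set X) : Prop :=
  CaseA K L ∨ CaseB K L ∨ CaseC K L ∨ CaseD K L ∨ CaseE K L

/-- Condition (1) of Theorem 5: every intersection of congruent copies admits some
non-trivial congruence. -/
def T5Cond1 (K L : Set X) : Prop :=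
  ∀ φ ψ : X ≃ᵢ X, OrientationPreserving φ → OrientationPreserving ψ →
    (interior ((⇑φ '' K) ∩ (⇑ψ '' L))).Nonempty →
    AdmitsNontrivialCongruence ((⇑φ '' K) ∩ (⇑ψ '' L))

/-- Condition (2) of Theorem 5: every intersection of congruent copies is axially
symmetric. -/
def T5Cond2 (K L : Set X) : Prop :=
  ∀ φ ψ : X ≃ᵢ X, OrientationPreserving φ → OrientationPreserving ψ →
    (interior ((⇑φ '' K) ∩ (⇑ψ '' L))).Nonempty →
    AxiallySymmetric ((⇑φ '' K) ∩ (⇑ψ '' L))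

/-- All connected components of the boundary of `K` are hypercycles or straight lines. -/
def BdryHypOrLine (K : Set X) : Prop :=
  ∀ x ∈ frontier K, IsHypercycleOrLine (connectedComponentIn (frontier K) x)

/-- The boundary of `K` has at least two connected components. -/
def AtLeastTwoComponents (K : Set X) : Prop :=
  ∃ x ∈ frontier K, ∃ y ∈ frontier K,
    connectedComponentIn (frontier K) x ≠ connectedComponentIn (frontier K) y

/-- The boundary of `K` is nonempty and has a single connected component. -/
def SingleComponent (K : Set X) : Prop :=
  (frontier K).Nonempty ∧ ∀ x ∈ frontier K, ∀ y ∈ frontier K,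
    connectedComponentIn (frontier K) x = connectedComponentIn (frontier K) y

/-- The associated graph of `K` contains two edges with at least one common endpoint:
`K` has two distinct boundary components which are asymptotic (come arbitrarily close). -/
def TwoAsymptoticComponents (K : Set X) : Prop :=
  ∃ x ∈ frontier K, ∃ y ∈ frontier K,
    connectedComponentIn (frontier K) x ≠ connectedComponentIn (frontier K) y ∧
    ∀ δ > (0 : ℝ), ∃ p ∈ connectedComponentIn (frontier K) x,
      ∃ q ∈ connectedComponentIn (frontier K) y, dist p q < δ

/-- The associated graph of `K` has only pairwise vertex-disjoint edges: distinct
boundary components of `K` stay at positive distance from each other. -/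
def VertexDisjointEdges (K : Set X) : Prop :=
  ∀ x ∈ frontier K, ∀ y ∈ frontier K,
    connectedComponentIn (frontier K) x ≠ connectedComponentIn (frontier K) y →
      ∃ δ > (0 : ℝ), ∀ p ∈ connectedComponentIn (frontier K) x,
        ∀ q ∈ connectedComponentIn (frontier K) y, δ ≤ dist p q

/-! Conditions of Theorem 6. -/

/-- Condition (1) of Theorem 6. -/
def T6Cond1 (K L : Set X) : Prop :=
  ∃ ε > (0 : ℝ), ∀ φ ψ : X ≃ᵢ X, OrientationPreserving φ → OrientationPreserving ψ →
    (interior ((⇑φ '' K) ∩ (⇑ψ '' L))).Nonempty →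
    diam ((⇑φ '' K) ∩ (⇑ψ '' L)) < ε →
    CentrallySymmetric ((⇑φ '' K) ∩ (⇑ψ '' L))

/-- Condition (2) of Theorem 6. -/
def T6Cond2 (K L : Set X) : Prop :=
  ∀ x ∈ frontier K, ∀ y ∈ frontier L, ∃ ε > (0 : ℝ),
    ∀ φ ψ : X ≃ᵢ X, OrientationPreserving φ → OrientationPreserving ψ →
      (interior ((⇑φ '' K) ∩ (⇑ψ '' L))).Nonempty →
      diam ((⇑φ '' K) ∩ (⇑ψ '' L)) < ε →
      ∀ (p : X) (r : ℝ), HasUniqueInball ((⇑φ '' K) ∩ (⇑ψ '' L)) p r →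
        frontier ((⇑φ '' K) ∩ (⇑ψ '' L)) ∩ sphere p r = {φ x, ψ y} →
        φ x ∈ interior (⇑ψ '' L) → ψ y ∈ interior (⇑φ '' K) →
        IsMidpoint p (φ x) (ψ y) →
        CentrallySymmetric ((⇑φ '' K) ∩ (⇑ψ '' L))

/-- Condition (3) of Theorem 6. -/
def T6Cond3 (K L : Set X) : Prop :=
  ∀ x ∈ frontier K, ∀ y ∈ frontier L, ∃ ε > (0 : ℝ),
    ∀ φ ψ : X ≃ᵢ X, OrientationPreserving φ → OrientationPreserving ψ →
      (interior ((⇑φ '' K) ∩ (⇑ψ '' L))).Nonempty →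
      diam ((⇑φ '' K) ∩ (⇑ψ '' L)) < ε →
      ∀ (p : X) (r : ℝ), HasUniqueInball ((⇑φ '' K) ∩ (⇑ψ '' L)) p r →
        frontier ((⇑φ '' K) ∩ (⇑ψ '' L)) ∩ sphere p r = {φ x, ψ y} →
        φ x ∈ interior (⇑ψ '' L) → ψ y ∈ interior (⇑φ '' K) →
        IsMidpoint p (φ x) (ψ y) →
        SymmetricWrtPerpBisector ((⇑φ '' K) ∩ (⇑ψ '' L)) (φ x) (ψ y)

/-- Condition (4) of Theorem 6. -/
def T6Cond4 (d : ℕ) (K L : Set X) : Prop :=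
  (∃ r > (0 : ℝ), (IsSphereSpace X d → r ≤ Real.pi / 2) ∧
      (∀ C ∈ bdryComponents K ∪ bdryComponents L, ∃ p : X, C = sphere p r) ∧
      (∃ p : X, K = closedBall p r) ∧ ∃ q : X, L = closedBall q r) ∨
  ((∀ C ∈ bdryComponents K ∪ bdryComponents L, IsParasphere C) ∧
      IsParaball K ∧ IsParaball L) ∨
  (∃ lam > (0 : ℝ), ∀ C ∈ bdryComponents K ∪ bdryComponents L, IsHypersphere C lam)

/-! Conditions of Theorems 7 and 8. -/

/-- The pair `φ, ψ` is admissible for hypothesis (****): both are orientation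
preserving, and for the sphere `(φ K) ∪ (ψ L)` lies in an open hemisphere. -/
def GoodPair (d : ℕ) (K L : Set X) (φ ψ : X ≃ᵢ X) : Prop :=
  OrientationPreserving φ ∧ OrientationPreserving ψ ∧
    (IsSphereSpace X d → ∃ s : X, (⇑φ '' K) ∪ (⇑ψ '' L) ⊆ ball s (Real.pi / 2))

/-- The convex hull of the union of the two congruent copies. -/
def hullUnion (K L : Set X) (φ ψ : X ≃ᵢ X) : Set X := gconvexHull ((⇑φ '' K) ∪ (⇑ψ '' L))

/-- Condition (A) of (3) of Theorem 7: the diameter of `M` is sufficiently close to `π`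
(sphere), resp. sufficiently large (Euclidean, hyperbolic), as measured by `δ`. -/
def BigDiam (d : ℕ) (X : Type*) [MetricSpace X] (M : Set X) (δ : ℝ) : Prop :=
  (IsSphereSpace X d → Real.pi - δ < diam M) ∧ (¬ IsSphereSpace X d → 1 / δ < diam M)

/-- Condition (1) of Theorem 7. -/
def T7Cond1 (d : ℕ) (K L : Set X) : Prop :=
  ∀ φ ψ : X ≃ᵢ X, GoodPair d K L φ ψ → CentrallySymmetric (hullUnion K L φ ψ)

/-- Condition (2) of Theorem 7. -/
def T7Cond2 (d : ℕ) (K L : Set X) : Prop :=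
  ∀ φ ψ : X ≃ᵢ X, GoodPair d K L φ ψ → ∀ a b : X, UniqueDiametral (hullUnion K L φ ψ) a b →
    SymmetricWrtPerpBisector (hullUnion K L φ ψ) a b

/-- Condition (3) of Theorem 7. -/
def T7Cond3 (d : ℕ) (K L : Set X) : Prop :=
  ∃ δ > (0 : ℝ), ∀ φ ψ : X ≃ᵢ X, GoodPair d K L φ ψ →
    ∀ x ∈ frontier K, ∀ y ∈ frontier L,
      BigDiam d X (hullUnion K L φ ψ) δ →
      UniqueDiametral (hullUnion K L φ ψ) (φ x) (ψ y) →
      CentrallySymmetric (hullUnion K L φ ψ)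

/-- Condition (4) of Theorem 7. -/
def T7Cond4 (d : ℕ) (K L : Set X) : Prop :=
  ∃ δ > (0 : ℝ), ∀ φ ψ : X ≃ᵢ X, GoodPair d K L φ ψ →
    ∀ x ∈ frontier K, ∀ y ∈ frontier L,
      BigDiam d X (hullUnion K L φ ψ) δ →
      UniqueDiametral (hullUnion K L φ ψ) (φ x) (ψ y) →
      SymmetricWrtPerpBisector (hullUnion K L φ ψ) (φ x) (ψ y)

/-- Condition (5) of Theorem 7. -/
def T7Cond5 (d : ℕ) (K L : Set X) : Prop :=
  ∃ δ > (0 : ℝ), ∀ φ ψ : X ≃ᵢ X, GoodPair d K L φ ψ →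
    ∀ x ∈ frontier K, ∀ y ∈ frontier L,
      BigDiam d X (hullUnion K L φ ψ) δ →
      UniqueDiametral (hullUnion K L φ ψ) (φ x) (ψ y) →
      ∃ ε₀ > (0 : ℝ), ∀ ε : ℝ, 0 < ε → ε < ε₀ →
        (IsSphereSpace X d → ∃ s : X, (⇑φ '' K) ∪ (⇑ψ '' L) ⊆ ball s (Real.pi / 2) ∧
            segCyl (φ x) (ψ y) ε ⊆ ball s (Real.pi / 2)) ∧
        CentrallySymmetric (hullUnion K L φ ψ ∩ segCyl (φ x) (ψ y) ε)

/-- Condition (6) of Theorem 7. -/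
def T7Cond6 (d : ℕ) (K L : Set X) : Prop :=
  ∃ δ > (0 : ℝ), ∀ φ ψ : X ≃ᵢ X, GoodPair d K L φ ψ →
    ∀ x ∈ frontier K, ∀ y ∈ frontier L,
      BigDiam d X (hullUnion K L φ ψ) δ →
      UniqueDiametral (hullUnion K L φ ψ) (φ x) (ψ y) →
      ∃ ε₀ > (0 : ℝ), ∀ ε : ℝ, 0 < ε → ε < ε₀ →
        (IsSphereSpace X d → ∃ s : X, (⇑φ '' K) ∪ (⇑ψ '' L) ⊆ ball s (Real.pi / 2) ∧
            segCyl (φ x) (ψ y) ε ⊆ ball s (Real.pi / 2)) ∧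
        SymmetricWrtPerpBisector (hullUnion K L φ ψ ∩ segCyl (φ x) (ψ y) ε) (φ x) (ψ y)

/-- Condition (7) of Theorem 7: `K` and `L` are congruent balls. -/
def T7Cond7 (d : ℕ) (K L : Set X) : Prop :=
  ∃ r > (0 : ℝ), (IsSphereSpace X d → r < Real.pi / 2) ∧
    (∃ p : X, K = closedBall p r) ∧ ∃ q : X, L = closedBall q r

/-- Condition (1) of Theorem 8. -/
def T8Cond1 (K L : Set X) : Prop :=
  ∀ φ ψ : X ≃ᵢ X, GoodPair 2 K L φ ψ → AxiallySymmetric (hullUnion K L φ ψ)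

/-- Condition (2) of Theorem 8. -/
def T8Cond2 (K L : Set X) : Prop :=
  ∀ φ ψ : X ≃ᵢ X, GoodPair 2 K L φ ψ → AdmitsNontrivialCongruence (hullUnion K L φ ψ)

/-- Condition (3) of Theorem 8. -/
def T8Cond3 (K L : Set X) : Prop :=
  ∃ δ > (0 : ℝ), ∀ φ ψ : X ≃ᵢ X, GoodPair 2 K L φ ψ →
    ∀ x ∈ frontier K, ∀ y ∈ frontier L,
      BigDiam 2 X (hullUnion K L φ ψ) δ →
      UniqueDiametral (hullUnion K L φ ψ) (φ x) (ψ y) →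
      AxiallySymmetric (hullUnion K L φ ψ)

/-- Condition (4) of Theorem 8. -/
def T8Cond4 (K L : Set X) : Prop :=
  ∃ δ > (0 : ℝ), ∀ φ ψ : X ≃ᵢ X, GoodPair 2 K L φ ψ →
    ∀ x ∈ frontier K, ∀ y ∈ frontier L,
      BigDiam 2 X (hullUnion K L φ ψ) δ →
      UniqueDiametral (hullUnion K L φ ψ) (φ x) (ψ y) →
      AdmitsNontrivialCongruence (hullUnion K L φ ψ)

/-- Condition (5) of Theorem 8. -/
def T8Cond5 (K L : Set X) : Prop :=
  ∃ δ > (0 : ℝ), ∀ φ ψ : X ≃ᵢ X, GoodPair 2 K L φ ψ →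
    ∀ x ∈ frontier K, ∀ y ∈ frontier L,
      BigDiam 2 X (hullUnion K L φ ψ) δ →
      UniqueDiametral (hullUnion K L φ ψ) (φ x) (ψ y) →
      ∃ ε₀ > (0 : ℝ), ∀ ε : ℝ, 0 < ε → ε < ε₀ →
        (IsSphereSpace X 2 → ∃ s : X, (⇑φ '' K) ∪ (⇑ψ '' L) ⊆ ball s (Real.pi / 2) ∧
            segCyl (φ x) (ψ y) ε ⊆ ball s (Real.pi / 2)) ∧
        AxiallySymmetric (hullUnion K L φ ψ ∩ segCyl (φ x) (ψ y) ε)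

/-- Condition (6) of Theorem 8. -/
def T8Cond6 (K L : Set X) : Prop :=
  ∃ δ > (0 : ℝ), ∀ φ ψ : X ≃ᵢ X, GoodPair 2 K L φ ψ →
    ∀ x ∈ frontier K, ∀ y ∈ frontier L,
      BigDiam 2 X (hullUnion K L φ ψ) δ →
      UniqueDiametral (hullUnion K L φ ψ) (φ x) (ψ y) →
      ∃ ε₀ > (0 : ℝ), ∀ ε : ℝ, 0 < ε → ε < ε₀ →
        (IsSphereSpace X 2 → ∃ s : X, (⇑φ '' K) ∪ (⇑ψ '' L) ⊆ ball s (Real.pi / 2) ∧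
            segCyl (φ x) (ψ y) ε ⊆ ball s (Real.pi / 2)) ∧
        AdmitsNontrivialCongruence (hullUnion K L φ ψ ∩ segCyl (φ x) (ψ y) ε)

/-- Condition (7) of Theorem 8: `K` and `L` are (in general incongruent) circles. -/
def T8Cond7 (K L : Set X) : Prop :=
  ∃ (p q : X) (r s : ℝ), 0 < r ∧ 0 < s ∧
    (IsSphereSpace X 2 → r < Real.pi / 2 ∧ s < Real.pi / 2) ∧
    K = closedBall p r ∧ L = closedBall q s

/-- `i` is the inversion of the space in the point `x`. -/
structure PointInversion (sph : Prop) (x : X) (i : X ≃ᵢ X) : Prop where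
  inv : Function.Involutive i
  fix : i x = x
  dist_two : ∀ u, (sph → dist x u ≤ Real.pi / 2) → dist u (i u) = 2 * dist x u

/-- The metric properties shared by the three space forms; `sph` says that the
space is spherical, in which case geodesics are minimizing only up to length `π`. -/
structure Geo (X : Type*) [MetricSpace X] (sph : Prop) : Prop where
  proper : ProperSpace X
  dist_le : sph → ∀ x y : X, dist x y ≤ Real.pi
  line : ∀ x y : X, x ≠ y → ∃ γ : ℝ → X, γ 0 = x ∧ γ (dist x y) = y ∧
    ∀ s t : ℝ, (sph → |s - t| ≤ Real.pi) → dist (γ s) (γ t) = |s - t|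
  nonbranching : ∀ w c z z' : X, w ≠ c → Btw w c z → Btw w c z' →
    dist c z = dist c z' → z = z'
  swap : ∀ u v : X, u ≠ v → ∃ s : X ≃ᵢ X, Function.Involutive s ∧ s u = v ∧
    ∀ w, dist w u = dist w v → s w = w
  equidistant : ∀ u v : X, ∃ p q : X, p ≠ q ∧ dist u p = dist u q ∧ dist v p = dist v q
  inversion : ∀ x : X, ∃ i : X ≃ᵢ X, PointInversion sph x i

/-- `P` is one of the two closed sides of the fixed point set of the involution `σ`. -/
structure MirrorSide (σ : X ≃ᵢ X) (P : Set X) : Prop where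
  inv : Function.Involutive σ
  moves : ∃ w, σ w ≠ w
  closed : IsClosed P
  cover : ∀ w, w ∈ P ∨ σ w ∈ P
  mem_of_fixed : ∀ w, σ w = w → w ∈ P
  fixed : ∀ w, w ∈ P → σ w ∈ P → σ w = w

/-- The points at least as close to `u` as to `v`. -/
def nearSide (u v : X) : Set X := {w | dist w u ≤ dist w v}

variable {sph : Prop}

theorem Btw.symm {x z y : X} (h : Btw x z y) : Btw y z x := by
  unfold Btw at *
  rw [dist_comm y z, dist_comm z x, dist_comm y x]
  linarith

theorem Btw.map {x z y : X} (h : Btw x z y) (f : X ≃ᵢ X) : Btw (f x) (f z) (f y) := by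
  simpa [Btw, f.isometry.dist_eq] using h

theorem Btw.trans_left {a b c e : X} (h : Btw a b e) (h' : Btw b c e) : Btw a b c := by
  unfold Btw at *
  linarith [dist_triangle a b c, dist_triangle a c e]

theorem Btw.trans_right {a b c e : X} (h : Btw a b e) (h' : Btw b c e) : Btw a c e := by
  unfold Btw at *
  linarith [dist_triangle a b c, dist_triangle a c e]

theorem Btw.of_le {x z y : X} (h : dist x z + dist z y ≤ dist x y) : Btw x z y :=
  le_antisymm h (dist_triangle x z y)

theorem Geo.point (G : Geo X sph) (x y : X) {t : ℝ} (h0 : 0 ≤ t) (h1 : t ≤ dist x y) :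
    ∃ z, Btw x z y ∧ dist x z = t := by
  by_cases hxy : x = y
  · subst hxy
    exact ⟨x, by simp [Btw], by simp at h1 ⊢; linarith⟩
  obtain ⟨γ, g0, g1, g⟩ := G.line x y hxy
  have e1 : dist (γ 0) (γ t) = |0 - t| := g 0 t fun h => by
    have := G.dist_le h x y
    rw [abs_le]; constructor <;> linarith
  have e2 : dist (γ t) (γ (dist x y)) = |t - dist x y| := g _ _ fun h => by
    have := G.dist_le h x y
    rw [abs_le]; constructor <;> linarith
  rw [g0, zero_sub, abs_neg, abs_of_nonneg h0] at e1
  rw [g1, abs_sub_comm, abs_of_nonneg (by linarith)] at e2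
  exact ⟨γ t, by unfold Btw; linarith, e1⟩

theorem Geo.extend (G : Geo X sph) {x y : X} (hxy : x ≠ y) {t : ℝ} (h0 : 0 ≤ t)
    (h1 : sph → dist x y + t ≤ Real.pi) : ∃ z, Btw x y z ∧ dist y z = t := by
  obtain ⟨γ, g0, g1, g⟩ := G.line x y hxy
  have hd : 0 ≤ dist x y := dist_nonneg
  have e1 : dist (γ 0) (γ (dist x y + t)) = |0 - (dist x y + t)| := g _ _ fun h => by
    have := h1 h
    rw [abs_le]; constructor <;> linarith
  have e2 : dist (γ (dist x y)) (γ (dist x y + t)) = |dist x y - (dist x y + t)| :=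
    g _ _ fun h => by
      have := h1 h
      rw [abs_le]; constructor <;> linarith
  rw [g0, zero_sub, abs_neg, abs_of_nonneg (by linarith)] at e1
  rw [g1, abs_sub_comm, abs_of_nonneg (by linarith)] at e2
  exact ⟨γ (dist x y + t), by unfold Btw; linarith, by linarith⟩

theorem Geo.btw_unique (G : Geo X sph) {x z z' y : X} (h : Btw x z y) (h' : Btw x z' y)
    (e : dist x z = dist x z') (hs : sph → dist x y < Real.pi) : z = z' := by
  by_cases hxy : x = y
  · subst hxy
    have a : dist x z = 0 := by
      unfold Btw at h
      rw [dist_self, dist_comm z x] at h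
      linarith
    rw [a] at e
    rw [← dist_eq_zero.1 a, ← dist_eq_zero.1 e.symm]
  obtain ⟨η, hη, hηs⟩ : ∃ η > (0 : ℝ), sph → dist y x + η ≤ Real.pi := by
    by_cases hsph : sph
    · exact ⟨Real.pi - dist y x, by have := hs hsph; rw [dist_comm y x]; linarith,
        fun _ => by linarith⟩
    · exact ⟨1, one_pos, fun h => absurd h hsph⟩
  obtain ⟨x', hx', ex'⟩ := G.extend (Ne.symm hxy) hη.le hηs
  refine G.nonbranching x' x z z' ?_ ?_ ?_ e
  · rintro rfl
    simp at ex'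
    linarith
  · exact hx'.symm.trans_left h
  · exact hx'.symm.trans_left h'

theorem Geo.uniqueBtwPt (G : Geo X sph) {x z y : X} (h : Btw x z y)
    (hs : sph → dist x y < Real.pi) : UniqueBtwPt x z y :=
  ⟨h, fun _ hw e => G.btw_unique hw h e hs⟩

theorem MirrorSide.map_mem {σ : X ≃ᵢ X} {P : Set X} (H : MirrorSide σ P) {w : X}
    (hw : w ∉ P) : σ w ∈ P := (H.cover w).resolve_left hw

theorem MirrorSide.dist_map {σ : X ≃ᵢ X} {P : Set X} (H : MirrorSide σ P) (a b : X) :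
    dist (σ a) b = dist a (σ b) := by
  rw [← σ.isometry.dist_eq a (σ b), H.inv b]

theorem Geo.segment (G : Geo X sph) {x y : X} (hxy : x ≠ y) :
    ∃ A : Set X, IsPreconnected A ∧ x ∈ A ∧ y ∈ A ∧ ∀ z ∈ A, Btw x z y := by
  obtain ⟨γ, g0, g1, g⟩ := G.line x y hxy
  have hd : 0 ≤ dist x y := dist_nonneg
  have key : ∀ s ∈ Icc 0 (dist x y), ∀ t ∈ Icc 0 (dist x y), dist (γ s) (γ t) = |s - t| := by
    intro s hs t ht
    apply g
    intro h
    have := G.dist_le h x y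
    rw [abs_le]; constructor <;> linarith [hs.1, hs.2, ht.1, ht.2]
  refine ⟨γ '' Icc 0 (dist x y), ?_, ⟨0, by simp, g0⟩, ⟨dist x y, by simp, g1⟩, ?_⟩
  · refine isPreconnected_Icc.image _ ?_
    rw [Metric.continuousOn_iff]
    intro b hb ε hε
    exact ⟨ε, hε, fun a ha hab => by rw [key a ha b hb]; exact hab⟩
  · rintro _ ⟨t, ht, rfl⟩
    have e1 := key 0 (by simp) t ht
    have e2 := key t ht (dist x y) (by simp)
    rw [g0, zero_sub, abs_neg, abs_of_nonneg ht.1] at e1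
    rw [g1, abs_sub_comm, abs_of_nonneg (by linarith [ht.2])] at e2
    unfold Btw
    linarith

theorem Geo.crossing (G : Geo X sph) {σ : X ≃ᵢ X} {P : Set X} (H : MirrorSide σ P) {w w' : X}
    (hw : w ∈ P) (hw' : σ w' ∈ P) : ∃ c, Btw w c w' ∧ σ c = c := by
  by_cases h : w = w'
  · subst h
    exact ⟨w, by simp [Btw], H.fixed _ hw hw'⟩
  obtain ⟨A, hA, hx, hy, hb⟩ := G.segment h
  obtain ⟨c, hcA, hc1, hc2⟩ := isPreconnected_closed_iff.1 hA P (σ ⁻¹' P) H.closed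
    (H.closed.preimage σ.continuous) (fun z _ => H.cover z) ⟨w, hx, hw⟩ ⟨w', hy, hw'⟩
  exact ⟨c, hb c hcA, H.fixed _ hc1 hc2⟩

theorem Geo.dist_lt (G : Geo X sph) {σ : X ≃ᵢ X} {P : Set X} (H : MirrorSide σ P) {w z : X}
    (hw : w ∈ P) (hz : z ∈ P) (hwf : σ w ≠ w) (hzf : σ z ≠ z) : dist w z < dist w (σ z) := by
  obtain ⟨c, hc, hcf⟩ := G.crossing H hw (w' := σ z) (by rwa [H.inv z])
  have e : dist c (σ z) = dist c z := by rw [← H.dist_map, hcf]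
  have hle : dist w z ≤ dist w (σ z) := by
    unfold Btw at hc
    linarith [dist_triangle w c z]
  refine lt_of_le_of_ne hle fun heq => hzf ?_
  refine (G.nonbranching w c z (σ z) ?_ ?_ hc e.symm).symm
  · rintro rfl
    exact hwf hcf
  · unfold Btw at *
    linarith

theorem Geo.eq_nearSide (G : Geo X sph) {σ : X ≃ᵢ X} {P : Set X} (H : MirrorSide σ P) {z : X}
    (hz : z ∈ P) (hzf : σ z ≠ z) : P = nearSide z (σ z) := by
  ext w
  constructor
  · intro hw
    by_cases hwf : σ w = w
    · change dist w z ≤ dist w (σ z)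
      rw [← H.dist_map, hwf]
    · exact (G.dist_lt H hw hz hwf hzf).le
  · intro hw
    by_contra hwP
    have hwf : σ w ≠ w := fun h => hwP (H.mem_of_fixed w h)
    have := G.dist_lt H (H.map_mem hwP) hz (fun h => hwf (σ.injective h)) hzf
    rw [H.dist_map, H.dist_map, H.inv z] at this
    exact absurd hw (not_le.2 this)

theorem Geo.not_mem_of_through (G : Geo X sph) {σ : X ≃ᵢ X} {P : Set X} (H : MirrorSide σ P)
    {m a w : X} (ha : σ a = a) (hm : m ∈ P) (hmf : σ m ≠ m) (hb : Btw m a w) (hwa : w ≠ a) :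
    w ∉ P := by
  intro hw
  by_cases hwf : σ w = w
  · refine hmf (G.nonbranching w a m (σ m) hwa hb.symm ?_ ?_).symm
    · have := hb.symm.map σ
      rwa [hwf, ha] at this
    · rw [← H.dist_map, ha]
  · have h1 := G.dist_lt H hm hw hmf hwf
    have h2 := dist_triangle m a (σ w)
    rw [← H.dist_map a, ha] at h2
    unfold Btw at hb
    linarith

theorem mirrorSide_nearSide {u v : X} (huv : u ≠ v) {s : X ≃ᵢ X} (hs : Function.Involutive s)
    (hsu : s u = v) (hf : ∀ w, dist w u = dist w v → s w = w) : MirrorSide s (nearSide u v) := by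
  have hsv : s v = u := by rw [← hsu, hs u]
  have e1 : ∀ w, dist (s w) u = dist w v := fun w => by rw [← s.isometry.dist_eq w v, hsv]
  have e2 : ∀ w, dist (s w) v = dist w u := fun w => by rw [← s.isometry.dist_eq w u, hsu]
  refine ⟨hs, ⟨u, by rw [hsu]; exact huv.symm⟩, ?_, ?_, ?_, ?_⟩
  · exact isClosed_le (by fun_prop) (by fun_prop)
  · intro w
    simp only [nearSide, mem_ofPred_eq, e1, e2]
    exact le_total _ _
  · intro w hw
    have := e1 w
    rw [hw] at this
    exact this.le
  · intro w h1 h2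
    simp only [nearSide, mem_ofPred_eq, e1, e2] at h1 h2
    exact hf w (le_antisymm h1 h2)

theorem Geo.exists_mirrorSide (G : Geo X sph) {u v : X} (huv : u ≠ v) :
    ∃ s : X ≃ᵢ X, s u = v ∧ (∀ w, dist w u = dist w v → s w = w) ∧
      MirrorSide s (nearSide u v) := by
  obtain ⟨s, h1, h2, h3⟩ := G.swap u v huv
  exact ⟨s, h2, h3, mirrorSide_nearSide huv h1 h2 h3⟩

theorem Geo.isReflection (G : Geo X sph) {u v : X} (huv : u ≠ v) :
    ∃ s : X ≃ᵢ X, IsReflection s ∧ s u = v ∧ (∀ w, dist w u = dist w v → s w = w) ∧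
      MirrorSide s (nearSide u v) := by
  obtain ⟨s, h2, h3, H⟩ := G.exists_mirrorSide huv
  refine ⟨s, ⟨?_, ?_, ?_⟩, h2, h3, H⟩
  · ext w
    exact H.inv w
  · intro h
    rw [h] at h2
    exact huv h2
  · intro hc
    have hsv : s v = u := by rw [← h2, H.inv u]
    obtain ⟨w, hw, h4, h5⟩ := hc {w | dist w u < dist w v} {w | dist w v < dist w u}
      (isOpen_lt (by fun_prop) (by fun_prop)) (isOpen_lt (by fun_prop) (by fun_prop))
      (fun w hw => lt_or_gt_of_ne fun h => hw (h3 w h))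
      ⟨u, by simpa [h2] using huv.symm, by simpa using huv⟩
      ⟨v, by simpa [hsv] using huv, by simpa using huv.symm⟩
    exact lt_asymm (show dist w u < dist w v from h4) h5

theorem isHalfspace_nearSide {u v : X} {s : X ≃ᵢ X} (hs : IsReflection s)
    (H : MirrorSide s (nearSide u v)) : IsHalfspace (nearSide u v) := by
  refine ⟨s, hs, H.closed, ?_, ?_⟩
  · ext w
    refine ⟨fun _ => mem_univ _, fun _ => ?_⟩
    rcases H.cover w with h | h
    · exact Or.inl h
    · exact Or.inr ⟨s w, h, H.inv w⟩
  · ext w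
    constructor
    · rintro ⟨h, w', hw', rfl⟩
      have := H.fixed w' hw' h
      change s (s w') = s w'
      rw [this, this]
    · intro h
      exact ⟨H.mem_of_fixed w h, w, H.mem_of_fixed w h, h⟩

theorem IsHalfspace.mirrorSide {P : Set X} (h : IsHalfspace P) :
    ∃ σ : X ≃ᵢ X, MirrorSide σ P := by
  obtain ⟨σ, ⟨h1, h2, -⟩, hc, hu, hi⟩ := h
  have inv : Function.Involutive σ := fun w => by
    have := congrArg (fun f : X ≃ᵢ X => f w) h1
    exact this
  refine ⟨σ, inv, ?_, hc, ?_, ?_, ?_⟩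
  · by_contra hn
    push Not at hn
    exact h2 (by ext w; exact hn w)
  · intro w
    have : w ∈ P ∪ σ '' P := by rw [hu]; trivial
    rcases this with h | ⟨w', h, rfl⟩
    · exact Or.inl h
    · right
      rwa [inv w']
  · intro w hw
    have : w ∈ P ∩ σ '' P := by rw [hi]; exact hw
    exact this.1
  · intro w hw hw'
    have : w ∈ P ∩ σ '' P := ⟨hw, σ w, hw', inv w⟩
    rw [hi] at this
    exact this

theorem MirrorSide.fixed_of_frontier {σ : X ≃ᵢ X} {P : Set X} (H : MirrorSide σ P) {x : X}
    (hx : x ∈ frontier P) : σ x = x := by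
  have hxP : x ∈ P := H.closed.frontier_subset hx
  by_contra hne
  have hn : x ∉ σ ⁻¹' P := fun h => hne (H.fixed x hxP h)
  have hopen : IsOpen (σ ⁻¹' P)ᶜ := (H.closed.preimage σ.continuous).isOpen_compl
  have hsub : (σ ⁻¹' P)ᶜ ⊆ P := fun w hw => (H.cover w).resolve_right hw
  exact hx.2 (interior_maximal hsub hopen hn)

theorem Geo.gconvex (G : Geo X sph) {σ : X ≃ᵢ X} {P : Set X} (H : MirrorSide σ P) :
    GConvex P := by
  intro w₁ h₁ w₂ h₂ z hz
  by_contra hzP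
  obtain ⟨c₁, b₁, f₁⟩ := G.crossing H h₁ (H.map_mem hzP)
  obtain ⟨c₂, b₂, f₂⟩ := G.crossing H h₂ (H.map_mem hzP)
  have e₁ : dist c₁ (σ z) = dist c₁ z := by rw [← H.dist_map, f₁]
  have e₂ : dist c₂ (σ z) = dist c₂ z := by rw [← H.dist_map, f₂]
  have t₁ := dist_triangle w₁ c₁ (σ z)
  have t₂ := dist_triangle w₂ c₂ (σ z)
  have t := dist_triangle w₁ (σ z) w₂
  have hb := hz.1
  unfold Btw at b₁ b₂ hb
  rw [dist_comm (σ z) w₂] at t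
  rw [dist_comm z w₂] at hb
  have hzf : σ z = z := by
    apply hz.2
    · unfold Btw
      rw [dist_comm (σ z) w₂]
      linarith
    · linarith
  exact hzP (H.mem_of_fixed z hzf)

theorem PointInversion.dist_map {x : X} {i : X ≃ᵢ X} (I : PointInversion sph x i) (u : X) :
    dist x (i u) = dist x u := by
  conv_lhs => rw [← I.fix]
  exact i.isometry.dist_eq x u

theorem PointInversion.btw {x : X} {i : X ≃ᵢ X} (I : PointInversion sph x i) {u : X}
    (hu : sph → dist x u ≤ Real.pi / 2) : Btw u x (i u) := by
  unfold Btw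
  rw [I.dist_two u hu, I.dist_map, dist_comm u x]
  ring

theorem Geo.eq_inversion (G : Geo X sph) {x : X} {i : X ≃ᵢ X} (I : PointInversion sph x i)
    {u u' : X} (hu : sph → dist x u ≤ Real.pi / 2) (hux : u ≠ x) (hb : Btw u x u')
    (hd : dist x u' = dist x u) : u' = i u :=
  G.nonbranching u x u' (i u) hux hb (I.btw hu) (by rw [hd, I.dist_map])

theorem Geo.inversion_comm (G : Geo X sph) {x : X} {i τ : X ≃ᵢ X} (I : PointInversion sph x i)
    (hτ : τ x = x) {u : X} (hu : sph → dist x u ≤ Real.pi / 2) : τ (i u) = i (τ u) := by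
  have e : dist x (τ u) = dist x u := by
    conv_lhs => rw [← hτ]
    exact τ.isometry.dist_eq x u
  have e' : dist x (τ (i u)) = dist x u := by
    rw [← I.dist_map u, ← τ.isometry.dist_eq x (i u), hτ]
  by_cases hux : u = x
  · subst hux
    rw [I.fix, hτ, I.fix]
  · refine G.eq_inversion I (by rwa [e]) ?_ ?_ (by rw [e, e'])
    · intro h
      exact hux (τ.injective (h.trans hτ.symm))
    · have := (I.btw hu).map τ
      rwa [hτ] at this

theorem Geo.not_fixed_ball (G : Geo X sph) {σ : X ≃ᵢ X} {P : Set X} (H : MirrorSide σ P)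
    {z : X} {r : ℝ} (hr : 0 < r) (hB : ∀ w ∈ closedBall z r, σ w = w) : False := by
  obtain ⟨w, hw⟩ := H.moves
  have hz : σ z = z := hB z (mem_closedBall_self hr.le)
  have hzw : z ≠ w := by
    rintro rfl
    exact hw hz
  obtain ⟨c, hc, hcd⟩ := G.point z w (t := min r (dist z w))
    (le_min hr.le dist_nonneg) (min_le_right _ _)
  have hcB : σ c = c := hB c (by rw [mem_closedBall, dist_comm, hcd]; exact min_le_left _ _)
  refine hw (G.nonbranching z c w (σ w) ?_ hc ?_ ?_).symm
  · rintro rfl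
    rw [dist_self] at hcd
    exact absurd hcd (ne_of_lt (lt_min hr (dist_pos.2 hzw)))
  · have := hc.map σ
    rwa [hz, hcB] at this
  · rw [← H.dist_map, hcB]

theorem Geo.tangent (G : Geo X sph) {σ : X ≃ᵢ X} {P : Set X} (H : MirrorSide σ P)
    {x z : X} {r : ℝ} (hx : σ x = x) (hr : 0 < r) (hd : dist z x = r)
    (hB : closedBall z r ⊆ P) : σ z ≠ z ∧ Btw z x (σ z) := by
  have hzP : z ∈ P := hB (mem_closedBall_self hr.le)
  have hzf : σ z ≠ z := by
    intro hz
    refine G.not_fixed_ball H (z := z) hr fun w hw => H.fixed w (hB hw) (hB ?_)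
    rwa [mem_closedBall, H.dist_map, hz]
  refine ⟨hzf, ?_⟩
  have e : dist x (σ z) = r := by rw [← H.dist_map, hx, dist_comm, hd]
  by_contra hn
  have hlt : dist z (σ z) < 2 * r := by
    by_contra h
    exact hn (Btw.of_le (by linarith))
  have hpos : 0 < dist z (σ z) := dist_pos.2 hzf.symm
  obtain ⟨c, hc, hcd⟩ := G.point z (σ z) (t := min r (dist z (σ z)))
    (le_min hr.le dist_nonneg) (min_le_right _ _)
  have hcP : c ∈ P := hB (by rw [mem_closedBall, dist_comm, hcd]; exact min_le_left _ _)
  rw [G.eq_nearSide H hzP hzf] at hcP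
  change dist c z ≤ dist c (σ z) at hcP
  rw [dist_comm c z] at hcP
  unfold Btw at hc
  rcases min_choice r (dist z (σ z)) with h | h <;> rw [h] at hcd <;> linarith

theorem Geo.tangent_eq (G : Geo X sph) {σ : X ≃ᵢ X} {P : Set X} (H : MirrorSide σ P)
    {x z : X} {r : ℝ} {i : X ≃ᵢ X} (I : PointInversion sph x i) (hx : σ x = x) (hr : 0 < r)
    (hd : dist z x = r) (hrs : sph → r ≤ Real.pi / 2) (hB : closedBall z r ⊆ P) :
    σ z = i z ∧ P = nearSide z (i z) := by
  obtain ⟨h1, h2⟩ := G.tangent H hx hr hd hB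
  have e : σ z = i z := by
    refine G.eq_inversion I (by rwa [dist_comm, hd]) ?_ h2 ?_
    · rintro rfl
      simp at hd
      linarith
    · rw [← H.dist_map, hx]
  exact ⟨e, by rw [← e]; exact G.eq_nearSide H (hB (mem_closedBall_self hr.le)) h1⟩

theorem ball_subset_nearSide {x m : X} {i : X ≃ᵢ X} {r : ℝ} (I : PointInversion sph x i)
    (hd : dist x m = r) (hrs : sph → r ≤ Real.pi / 2) :
    closedBall m r ⊆ nearSide m (i m) := by
  intro w hw
  have h2 := I.dist_two m (by rwa [hd])
  have h3 := dist_triangle m w (i m)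
  rw [mem_closedBall] at hw
  change dist w m ≤ dist w (i m)
  rw [dist_comm m w] at h3
  linarith

theorem Geo.dist_lt_inversion (G : Geo X sph) {x m : X} {i : X ≃ᵢ X} {r : ℝ}
    (I : PointInversion sph x i) (hd : dist x m = r) (hrs : sph → r < Real.pi / 2) {w : X}
    (hw : dist w m ≤ r) (hwx : w ≠ x) : dist w m < dist w (i m) := by
  by_contra h
  push Not at h
  have h2 := I.dist_two m (by rw [hd]; exact fun hs => (hrs hs).le)
  have h3 := dist_triangle m w (i m)
  have hc : dist m w = dist w m := dist_comm m w
  refine hwx (G.btw_unique (x := m) (y := i m) (Btw.of_le (by linarith))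
    (I.btw (by rw [hd]; exact fun hs => (hrs hs).le)) ?_ ?_)
  · rw [dist_comm m x]
    linarith
  · intro hs
    have := hrs hs
    linarith

theorem Geo.strict_ball (G : Geo X sph) {m x y z : X} {ρ : ℝ} (hρ : sph → ρ < Real.pi / 2)
    (hx : dist x m ≤ ρ) (hy : dist y m ≤ ρ) (hb : Btw x z y) (hzx : z ≠ x) (hzy : z ≠ y) :
    dist z m < ρ := by
  by_contra h
  push Not at h
  obtain ⟨z', hb', hzx', hzy', h1, h2⟩ : ∃ z', Btw x z' y ∧ z' ≠ x ∧ z' ≠ y ∧ ρ ≤ dist z' m ∧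
      (sph → dist z' m < Real.pi / 2) := by
    by_cases hs : sph ∧ Real.pi / 2 ≤ dist z m
    · have hρ' := hρ hs.1
      obtain ⟨A, hA, hxA, hzA, hAb⟩ := G.segment (Ne.symm hzx)
      obtain ⟨z', hz', e⟩ := hA.intermediate_value (f := fun w => dist w m) hxA hzA (by fun_prop)
        (show (ρ + Real.pi / 2) / 2 ∈ _ from ⟨by linarith, by linarith [hs.2]⟩)
      simp only at e
      refine ⟨z', (hb.symm.trans_right (hAb z' hz').symm).symm, ?_, ?_, by linarith,
        fun _ => by linarith⟩
      · rintro rfl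
        linarith
      · rintro rfl
        linarith
    · refine ⟨z, hb, hzx, hzy, h, fun h' => ?_⟩
      by_contra hn
      exact hs ⟨h', not_lt.1 hn⟩
  obtain ⟨i, I⟩ := G.inversion z'
  have hd : dist z' m = dist z' m := rfl
  have strict : ∀ w, dist w m ≤ ρ → w ≠ z' → dist w m < dist w (i m) := fun w hw hne =>
    G.dist_lt_inversion I rfl h2 (hw.trans h1) hne
  have hx' := strict x hx hzx'.symm
  have hy' := strict y hy hzy'.symm
  have hmi : m ≠ i m := fun e => by
    rw [← e] at hx'
    exact lt_irrefl _ hx'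
  obtain ⟨σ, s1, s2, H⟩ := G.exists_mirrorSide hmi
  have hz' : σ z' = z' := s2 z' (I.dist_map m).symm
  have nf : ∀ w, dist w m < dist w (i m) → σ w ≠ w := fun w hw e => by
    rw [← s1, ← H.dist_map, e] at hw
    exact lt_irrefl _ hw
  have := G.dist_lt H (w := x) (z := y) hx'.le hy'.le (nf x hx') (nf y hy')
  have t := dist_triangle x z' (σ y)
  rw [← H.dist_map z', hz'] at t
  unfold Btw at hb'
  linarith

theorem Geo.gconvex_closedBall_diff (G : Geo X sph) {m w : X} {ρ : ℝ}
    (hρ : sph → ρ < Real.pi / 2) (hw : dist w m = ρ) : GConvex (closedBall m ρ \ {w}) := by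
  rintro x ⟨hx, hxw⟩ y ⟨hy, hyw⟩ z ⟨hz, -⟩
  by_cases hzx : z = x
  · rw [hzx]
    exact ⟨hx, hxw⟩
  by_cases hzy : z = y
  · rw [hzy]
    exact ⟨hy, hyw⟩
  have := G.strict_ball hρ hx hy hz hzx hzy
  refine ⟨this.le, ?_⟩
  rintro rfl
  linarith

theorem Geo.gconvex_closedBall (G : Geo X sph) {m : X} {ρ : ℝ}
    (hρ : sph → ρ < Real.pi / 2) : GConvex (closedBall m ρ) := by
  intro x hx y hy z hz
  by_cases hzx : z = x
  · rwa [hzx]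
  by_cases hzy : z = y
  · rwa [hzy]
  exact (G.strict_ball hρ hx hy hz.1 hzx hzy).le

theorem subset_gconvexHull (Y : Set X) : Y ⊆ gconvexHull Y :=
  fun _ hy _ hC => hC.2 hy

theorem gconvexHull_subset {Y C : Set X} (hC : GConvex C) (h : Y ⊆ C) : gconvexHull Y ⊆ C :=
  fun _ hy => hy C ⟨hC, h⟩

theorem Geo.reflect_onLine (G : Geo X sph) {a m b : X} {i σ : X ≃ᵢ X}
    (I : PointInversion sph a i) (hb : Btw a m b) (ham : a ≠ m) (hs : sph → dist a b < Real.pi)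
    (hσa : σ a = a) (hσm : σ m = i m) {z : X} (hz : OnLine a b z) : σ z = i z := by
  have eσ : ∀ u v, dist (σ u) (σ v) = dist u v := σ.isometry.dist_eq
  have ei : ∀ u v, dist (i u) (i v) = dist u v := i.isometry.dist_eq
  have hσb : σ b = i b := by
    refine G.nonbranching a (i m) _ _ ?_ ?_ ?_ ?_
    · rw [← I.fix]
      exact fun h => ham (i.injective (by rwa [I.fix] at h ⊢))
    · have := hb.map σ
      rwa [hσa, hσm] at this
    · have := hb.map i
      rwa [I.fix] at this
    · rw [ei, ← hσm, eσ]
  have hab : a ≠ b := by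
    rintro rfl
    unfold Btw at hb
    rw [dist_self, dist_comm m a] at hb
    exact ham (dist_eq_zero.1 (by linarith))
  have hda : ∀ u, dist a (σ u) = dist a u := fun u => by
    rw [← eσ a u, hσa]
  have hia : ∀ u, dist a (i u) = dist a u := I.dist_map
  rcases hz with h | h | h
  · refine G.btw_unique (x := a) (y := i b) ?_ ?_ ?_ ?_
    · have := h.map σ
      rwa [hσa, hσb] at this
    · have := h.map i
      rwa [I.fix] at this
    · rw [hda, hia]
    · rwa [hia]
  · refine G.nonbranching (i b) a _ _ ?_ ?_ ?_ ?_
    · intro e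
      rw [← I.fix] at e
      exact hab (i.injective e).symm
    · have := h.symm.map σ
      rwa [hσa, hσb] at this
    · have := h.symm.map i
      rwa [I.fix] at this
    · rw [hda, hia]
  · refine G.nonbranching a (i b) _ _ ?_ ?_ ?_ ?_
    · intro e
      rw [← I.fix] at e
      exact hab (i.injective e)
    · have := h.map σ
      rwa [hσa, hσb] at this
    · have := h.map i
      rwa [I.fix] at this
    · rw [ei, ← hσb, eσ]

theorem Geo.mem_perpDisc (G : Geo X sph) {a m b c : X} {i σ : X ≃ᵢ X} {ε : ℝ}
    (I : PointInversion sph a i) (hb : Btw a m b) (ham : a ≠ m) (hs : sph → dist a b < Real.pi)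
    (hσa : σ a = a) (hσm : σ m = i m) (hε : sph → ε ≤ Real.pi / 4) (hc : σ c = c)
    (hca : dist c a ≤ ε) : c ∈ perpDisc a b ε := by
  refine ⟨fun z hz => ?_, hca⟩
  have e := G.reflect_onLine I hb ham hs hσa hσm hz
  by_contra hlt
  push Not at hlt
  have hza : dist a z ≤ 2 * ε := by
    have := dist_triangle a c z
    rw [dist_comm a c] at this
    linarith
  have hzs : sph → dist a z ≤ Real.pi / 2 := fun h => by
    have := hε h
    linarith
  have hcz : dist c (i z) = dist c z := by
    rw [← e]
    conv_lhs => rw [← hc]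
    exact σ.isometry.dist_eq c z
  have hne : a ≠ z := by
    rintro rfl
    exact lt_irrefl _ hlt
  have hne' : a ≠ i z := fun h => hne (i.injective (by rw [← h, I.fix]))
  have := G.strict_ball (m := c) (ρ := dist c z) (x := z) (y := i z) (z := a)
    (fun h => by have := hε h; have := Real.pi_pos; linarith) (by rw [dist_comm])
    (by rw [dist_comm, hcz]) (I.btw hzs) hne hne'
  rw [dist_comm a c] at this
  linarith

theorem self_mem_perpDisc (a b : X) {ε : ℝ} (hε : 0 ≤ ε) : a ∈ perpDisc a b ε :=
  ⟨fun z _ => by rw [dist_self]; exact dist_nonneg, by rwa [dist_self]⟩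

theorem segCyl_comm (a b : X) (ε : ℝ) : segCyl a b ε = segCyl b a ε := by
  unfold segCyl
  rw [union_comm]

theorem left_mem_segCyl (a b : X) {ε : ℝ} (hε : 0 ≤ ε) : a ∈ segCyl a b ε :=
  subset_gconvexHull _ (Or.inl (self_mem_perpDisc a b hε))

/-- The cylinder around a segment contains a one-sided neighbourhood of its endpoints. -/
theorem Geo.exists_nhds_subset_segCyl (G : Geo X sph) {a m b : X} {ρ ε : ℝ} (hρ : 0 < ρ)
    (ham : dist a m = ρ) (hmb : dist m b = ρ) (hab : dist a b = 2 * ρ)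
    (hs : sph → ρ < Real.pi / 2) (hε : 0 < ε) (hεs : sph → ε ≤ Real.pi / 4) :
    ∃ η > 0, ∀ u, dist u a < η → dist u m ≤ ρ → u ∈ segCyl a b ε := by
  have := G.proper
  obtain ⟨i, I⟩ := G.inversion a
  have hne : a ≠ m := by
    rintro rfl
    simp at ham
    linarith
  have hb : Btw a m b := by
    unfold Btw
    linarith
  have him : m ≠ i m := fun h => by
    have := I.dist_two m (by rw [ham]; exact fun h => (hs h).le)
    rw [← h, dist_self] at this
    linarith
  have hbs : sph → dist a b < Real.pi := fun h => by
    have := hs h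
    linarith
  obtain ⟨σ, hσm, hσ, H⟩ := G.exists_mirrorSide him
  have hσa : σ a = a := hσ a (I.dist_map m).symm
  obtain ⟨η, hη, hηε, hηs⟩ : ∃ η > 0, η ≤ ε / 2 ∧ (sph → 2 * ρ + η < Real.pi) := by
    by_cases h : sph
    · have := hs h
      exact ⟨min (ε / 2) ((Real.pi - 2 * ρ) / 2), lt_min (by linarith) (by linarith),
        min_le_left _ _, fun _ => by
          linarith [min_le_right (ε / 2) ((Real.pi - 2 * ρ) / 2)]⟩
    · exact ⟨ε / 2, by linarith, le_rfl, fun h' => absurd h' h⟩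
  by_contra hcon
  push Not at hcon
  have hseq : ∀ n : ℕ, ∃ u, dist u a < min (η / (n + 1)) (2 * ρ) ∧ dist u m ≤ ρ ∧
      u ∉ segCyl a b ε := fun n => hcon _ (lt_min (by positivity) (by linarith))
  choose u hua hum huc using hseq
  have hext : ∀ n, ∃ v, Btw b (u n) v ∧ dist (u n) v = η := by
    intro n
    refine G.extend ?_ hη.le fun h => ?_
    · rintro rfl
      have := lt_of_lt_of_le (hua n) (min_le_right _ _)
      rw [dist_comm] at this
      linarith
    · have := hηs h
      have := dist_triangle b m (u n)
      rw [dist_comm b m, dist_comm m (u n)] at this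
      linarith [hum n]
  choose v hv hvd using hext
  have huη : ∀ n, dist (u n) a < η := fun n => by
    refine lt_of_lt_of_le (lt_of_lt_of_le (hua n) (min_le_left _ _)) ?_
    apply div_le_self hη.le
    have : (0 : ℝ) ≤ n := Nat.cast_nonneg n
    linarith
  have hvP : ∀ n, v n ∈ nearSide m (i m) := by
    intro n
    by_contra hn
    have huP : u n ∈ nearSide m (i m) :=
      ball_subset_nearSide I ham (fun h => (hs h).le) (hum n)
    obtain ⟨c, hc, hcf⟩ := G.crossing H huP (H.map_mem hn)
    have hbc : Btw b (u n) c := (hv n).trans_left hc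
    have hcu : dist (u n) c ≤ η := by
      unfold Btw at hc
      linarith [hvd n, dist_nonneg (x := c) (y := v n)]
    have hca : dist c a ≤ ε := by
      have := dist_triangle c (u n) a
      rw [dist_comm c (u n)] at this
      linarith [huη n]
    have hcD := G.mem_perpDisc I hb hne hbs hσa hσm hεs hcf hca
    refine huc n ?_
    intro C hC
    refine hC.1 b (hC.2 (Or.inr (self_mem_perpDisc b a hε.le))) c (hC.2 (Or.inl hcD)) _ ?_
    refine G.uniqueBtwPt hbc fun h => ?_
    have h1 := hηs h
    have h2 := dist_triangle b m (u n)
    rw [dist_comm b m, dist_comm m (u n)] at h2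
    have h3 := dist_triangle b (u n) c
    linarith [hum n]
  have hlim : Tendsto u atTop (nhds a) := by
    rw [tendsto_iff_dist_tendsto_zero]
    refine squeeze_zero (fun _ => dist_nonneg)
      (fun n => (lt_of_lt_of_le (hua n) (min_le_left _ _)).le) ?_
    have h := (tendsto_one_div_add_atTop_nhds_zero_nat (𝕜 := ℝ)).const_mul η
    simpa [div_eq_mul_inv] using h
  obtain ⟨w, -, φ, hφ, hw⟩ := (isCompact_closedBall a (2 * η)).tendsto_subseq (x := v)
    fun n => by
      rw [mem_closedBall, dist_comm]
      have := dist_triangle a (u n) (v n)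
      rw [dist_comm a (u n)] at this
      linarith [huη n, hvd n]
  have hwP : w ∈ nearSide m (i m) := H.closed.mem_of_tendsto hw (Eventually.of_forall
    fun n => hvP _)
  have hu' := hlim.comp hφ.tendsto_atTop
  have haw : dist a w = η := by
    refine tendsto_nhds_unique (hu'.dist hw) ?_
    simp only [Function.comp_def, hvd]
    exact tendsto_const_nhds
  have hbaw : Btw b a w := by
    unfold Btw
    have h1 : Tendsto (fun n => dist b (u (φ n)) + dist (u (φ n)) (v (φ n))) atTop
        (nhds (dist b a + dist a w)) := (tendsto_const_nhds.dist hu').add (hu'.dist hw)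
    have h2 : Tendsto (fun n => dist b (v (φ n))) atTop (nhds (dist b w)) :=
      tendsto_const_nhds.dist hw
    refine tendsto_nhds_unique h1 (h2.congr fun n => ?_)
    exact Eq.symm (hv (φ n))
  have hmaw : Btw m a w := (hbaw.symm.trans_left hb).symm
  refine G.not_mem_of_through H hσa ?_ ?_ hmaw ?_ hwP
  · change dist m m ≤ dist m (i m)
    rw [dist_self]
    exact dist_nonneg
  · rw [hσm]
    exact him.symm
  · rintro rfl
    simp at haw
    linarith

theorem one_lt_half_pi : (1 : ℝ) < Real.pi / 2 := by linarith [Real.pi_gt_three]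

theorem Geo.exists_eq_nearSide (G : Geo X sph) {τ i : X ≃ᵢ X} {P : Set X} {x : X}
    (H : MirrorSide τ P) (hx : τ x = x) (I : PointInversion sph x i) :
    ∃ u, u ≠ x ∧ (sph → dist x u < Real.pi / 2) ∧ u ∈ P ∧ P = nearSide u (i u) := by
  have h1 := one_lt_half_pi
  obtain ⟨w, hw⟩ := H.moves
  have hwx : x ≠ w := by
    rintro rfl
    exact hw hx
  have hD := dist_pos.2 hwx
  have hs0 : 0 < min (1 / 2) (dist x w) := lt_min (by norm_num) hD
  obtain ⟨c, hcb, hcs⟩ := G.point x w hs0.le (min_le_right (1 / 2) (dist x w))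
  have hcx : x ≠ c := by
    rintro rfl
    rw [dist_self] at hcs
    linarith
  have hc : τ c ≠ c := by
    intro hc
    have hb' := hcb.map τ
    rw [hx, hc] at hb'
    refine hw (G.nonbranching x c w (τ w) hcx hcb hb' ?_).symm
    conv_rhs => rw [← hc, τ.isometry.dist_eq]
  have hcs' : dist x c ≤ 1 / 2 := hcs ▸ min_le_left _ _
  obtain ⟨u, huP, hu, hus, hux⟩ : ∃ u, u ∈ P ∧ τ u ≠ u ∧ dist x u ≤ 1 / 2 ∧ u ≠ x := by
    rcases H.cover c with h | h
    · exact ⟨c, h, hc, hcs', hcx.symm⟩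
    · refine ⟨τ c, h, fun e => hc (τ.injective e), ?_, fun e => hcx ?_⟩
      · conv_lhs => rw [← hx, τ.isometry.dist_eq]
        exact hcs'
      · exact (τ.injective (e.trans hx.symm)).symm
  have hxτ : dist x (τ u) = dist x u := by
    conv_lhs => rw [← hx, τ.isometry.dist_eq]
  have husm : sph → dist x u ≤ Real.pi / 2 := fun _ => by linarith
  have hiu : i u ∉ P := by
    refine G.not_mem_of_through H hx huP hu (I.btw husm) fun e => hux ?_
    exact i.injective (e.trans I.fix.symm)
  have hivP : i (τ u) ∈ P := by
    rw [← G.inversion_comm I hx husm]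
    exact H.map_mem hiu
  have hle : dist u (i (τ u)) ≤ 1 := by
    have := dist_triangle u x (i (τ u))
    rw [I.dist_map, hxτ, dist_comm u x] at this
    linarith
  have hlt : sph → dist u (i (τ u)) < Real.pi := fun _ => by linarith
  obtain ⟨m, hmb, hm⟩ := G.point u (i (τ u)) (t := dist u (i (τ u)) / 2) (by positivity)
    (by linarith [dist_nonneg (x := u) (y := i (τ u))])
  have hm' : dist m (i (τ u)) = dist u (i (τ u)) / 2 := by
    have : _ + _ = _ := hmb
    linarith
  have hτm : τ m = i m := by
    have e1 : τ (i (τ u)) = i u := by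
      rw [G.inversion_comm I hx (fun h => hxτ ▸ husm h), H.inv]
    have b1 := hmb.map τ
    have b2 := (hmb.map i).symm
    rw [I.inv] at b2
    rw [e1] at b1
    refine G.btw_unique b1 b2 ?_ ?_
    · rw [τ.isometry.dist_eq, hm]
      conv_rhs => rw [← I.inv (τ u), i.isometry.dist_eq]
      rw [dist_comm _ m, hm']
    · intro h
      conv_lhs => rw [← e1, τ.isometry.dist_eq]
      exact hlt h
  have hmx : m ≠ x := by
    intro e
    rw [e] at hmb
    have := G.eq_inversion I husm hux hmb (by rw [I.dist_map, hxτ])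
    exact hu (i.injective this)
  have hms : dist x m ≤ 1 := by
    have := dist_triangle x u m
    linarith
  have hmP : m ∈ P := G.gconvex H u huP _ hivP m (G.uniqueBtwPt hmb hlt)
  refine ⟨m, hmx, fun _ => by linarith, hmP, ?_⟩
  rw [← hτm]
  refine G.eq_nearSide H hmP fun e => hmx ?_
  have := I.dist_two m (fun _ => by linarith)
  rw [← hτm, e, dist_self] at this
  exact (dist_eq_zero.1 (by linarith : dist x m = 0)).symm

theorem Geo.exists_tangent_ball (G : Geo X sph) {L : Set X} (hL : IsClosed L)
    (hi : (interior L).Nonempty) (hne : L ≠ univ) :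
    ∃ y ∈ frontier L, ∃ z r, 0 < r ∧ closedBall z r ⊆ L ∧ dist z y = r := by
  have := G.proper
  obtain ⟨z, hz⟩ := hi
  have hc : (closure Lᶜ).Nonempty := (nonempty_compl.2 hne).closure
  obtain ⟨y, hy, hd⟩ := isClosed_closure.exists_infDist_eq_dist hc z
  have hzy : z ≠ y := by
    rintro rfl
    rw [closure_compl] at hy
    exact hy hz
  have hball : ∀ w, dist z w < dist z y → w ∈ L := by
    intro w hw
    by_contra hwL
    have := infDist_le_dist_of_mem (x := z) (subset_closure (mem_compl hwL))
    linarith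
  have hcl : closedBall z (dist z y) ⊆ L := by
    intro w hw
    rw [mem_closedBall, dist_comm] at hw
    by_contra hwL
    rcases hw.lt_or_eq with h | h
    · exact hwL (hball w h)
    · have ho : Lᶜ ∈ nhds w := hL.isOpen_compl.mem_nhds hwL
      obtain ⟨η, hη, hb⟩ := Metric.mem_nhds_iff.1 ho
      have hp : 0 < dist z y := dist_pos.2 hzy
      have hmin : 0 < min (η / 2) (dist z y) := lt_min (by linarith) hp
      obtain ⟨c, hc1, hc2⟩ := G.point w z hmin.le (by
        rw [dist_comm w z, h]; exact min_le_right _ _)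
      have hcb : c ∈ ball w η := by
        rw [mem_ball, dist_comm, hc2]
        exact (min_le_left _ _).trans_lt (by linarith)
      refine hb hcb (hball c ?_)
      have : _ + _ = _ := hc1
      rw [dist_comm z c]
      rw [dist_comm w z] at this
      linarith
  refine ⟨y, ⟨subset_closure (hcl ?_), ?_⟩, z, dist z y, dist_pos.2 hzy, hcl, rfl⟩
  · rw [mem_closedBall, dist_comm]
  · rwa [closure_compl] at hy

theorem orientationPreserving_refl : OrientationPreserving (IsometryEquiv.refl X) :=
  ⟨[], by simp, by simp, rfl⟩

theorem orientationPreserving_trans {σ τ : X ≃ᵢ X} (hσ : IsReflection σ) (hτ : IsReflection τ) :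
    OrientationPreserving (σ.trans τ) :=
  ⟨[σ, τ], by simp [hσ, hτ], by simp, rfl⟩

theorem Geo.exists_fixing_reflection (G : Geo X sph) (u v : X) :
    ∃ s : X ≃ᵢ X, IsReflection s ∧ s u = u ∧ s v = v := by
  obtain ⟨p, q, hpq, hu, hv⟩ := G.equidistant u v
  obtain ⟨s, hs, -, hf, -⟩ := G.isReflection hpq
  exact ⟨s, hs, hf u hu, hf v hv⟩

theorem Geo.exists_orientationPreserving (G : Geo X sph) {y q b q' : X}
    (h : dist y q = dist b q') :
    ∃ ψ : X ≃ᵢ X, OrientationPreserving ψ ∧ ψ y = b ∧ ψ q = q' := by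
  have key : ∀ w, dist b w = dist b q' →
      ∃ τ : X ≃ᵢ X, IsReflection τ ∧ τ b = b ∧ τ w = q' := by
    intro w hw
    by_cases e : w = q'
    · obtain ⟨τ, hτ, h1, h2⟩ := G.exists_fixing_reflection b w
      exact ⟨τ, hτ, h1, h2.trans e⟩
    · obtain ⟨τ, hτ, h1, h2, -⟩ := G.isReflection e
      exact ⟨τ, hτ, h2 b hw, h1⟩
  obtain ⟨σ, hσ, hb⟩ : ∃ σ : X ≃ᵢ X, IsReflection σ ∧ σ y = b := by
    by_cases e : y = b
    · obtain ⟨σ, hσ, h1, -⟩ := G.exists_fixing_reflection y y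
      exact ⟨σ, hσ, h1.trans e⟩
    · obtain ⟨σ, hσ, h1, -⟩ := G.isReflection e
      exact ⟨σ, hσ, h1⟩
  obtain ⟨τ, hτ, h1, h2⟩ := key (σ q) (by rw [← hb, σ.isometry.dist_eq, h, hb])
  exact ⟨σ.trans τ, orientationPreserving_trans hσ hτ, by simp [hb, h1], by simp [h2]⟩

theorem Geo.supporting_nearSide (G : Geo X sph) {p x : X} {i : X ≃ᵢ X} {R : ℝ}
    (I : PointInversion sph x i) (hR : 0 < R) (hd : dist x p = R)
    (hs : sph → R < Real.pi / 2) :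
    IsHalfspace (nearSide p (i p)) ∧ closedBall p R ⊆ nearSide p (i p) ∧
      x ∈ frontier (nearSide p (i p)) := by
  have hxp : p ≠ x := by
    rintro rfl
    rw [dist_self] at hd
    linarith
  have hsm : sph → dist x p ≤ Real.pi / 2 := fun h => hd ▸ (hs h).le
  have hpi : p ≠ i p := by
    intro e
    have := I.dist_two p hsm
    rw [← e, dist_self] at this
    linarith
  obtain ⟨s, hrefl, hsp, hf, H⟩ := G.isReflection hpi
  have hx : dist x p = dist x (i p) := (I.dist_map p).symm
  refine ⟨isHalfspace_nearSide hrefl H, ball_subset_nearSide I hd fun h => (hs h).le, ?_⟩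
  refine ⟨subset_closure hx.le, fun hint => ?_⟩
  obtain ⟨η, hη, hb⟩ := Metric.mem_nhds_iff.1 (mem_interior_iff_mem_nhds.1 hint)
  have hmin : 0 < min (η / 2) (dist x p) := lt_min (by linarith) (by linarith)
  obtain ⟨c, hc1, hc2⟩ := G.point x (i p) hmin.le (by rw [← hx]; exact min_le_right _ _)
  have hcx : c ≠ x := by
    rintro rfl
    rw [dist_self] at hc2
    linarith
  refine G.not_mem_of_through (m := p) (a := x) H (hf x hx) (by simp [nearSide]) ?_ ?_ hcx (hb ?_)
  · rw [hsp]
    exact hpi.symm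
  · exact Btw.trans_left (I.btw hsm) hc1
  · rw [mem_ball, dist_comm, hc2]
    exact (min_le_left _ _).trans_lt (by linarith)

theorem Geo.gconvex_nearSide (G : Geo X sph) (u v : X) : GConvex (nearSide u v) := by
  by_cases h : u = v
  · subst h
    intro _ _ _ _ z _
    simp [nearSide]
  · obtain ⟨s, -, -, H⟩ := G.exists_mirrorSide h
    exact G.gconvex H

theorem PointInversion.dist_apply {x : X} {i : X ≃ᵢ X} (I : PointInversion sph x i) (u w : X) :
    dist u (i w) = dist (i u) w := by
  conv_rhs => rw [← I.inv w, i.isometry.dist_eq]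

theorem PointInversion.apply_ne {x u : X} {i : X ≃ᵢ X} (I : PointInversion sph x i)
    (hu : u ≠ x) (hs : sph → dist x u ≤ Real.pi / 2) : i u ≠ u := by
  intro e
  have := I.dist_two u hs
  rw [e, dist_self] at this
  exact hu (dist_eq_zero.1 (by linarith : dist x u = 0)).symm

/-- If a second half-space through `x` contains `K`, then tilting the tangent half-space at `x`
of the ball around `m` slightly towards it keeps both `K` and the compact set `A` inside. -/
theorem Geo.exists_tilted_side (G : Geo X sph) {x m u : X} {i : X ≃ᵢ X} {K A : Set X} {ρ : ℝ}
    (I : PointInversion sph x i) (hρ : 0 < ρ) (hm : dist x m = ρ) (hρs : sph → ρ < Real.pi / 2)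
    (hux : u ≠ x) (hus : sph → dist x u < Real.pi / 2)
    (hKm : K ⊆ nearSide m (i m)) (hKu : K ⊆ nearSide u (i u))
    (hne : nearSide m (i m) ≠ nearSide u (i u)) (hKi : (interior K).Nonempty)
    (hAc : IsCompact A) (hAm : A ⊆ closedBall m ρ) (hxA : x ∉ A) :
    ∃ v, v ≠ x ∧ (sph → dist x v < Real.pi / 2) ∧ K ∪ A ⊆ nearSide v (i v) ∧
      nearSide v (i v) ≠ nearSide m (i m) := by
  have hmx : m ≠ x := by
    rintro rfl
    rw [dist_self] at hm
    linarith
  have hmu : m ≠ u := by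
    rintro rfl
    exact hne rfl
  obtain ⟨g, hg, hgA⟩ : ∃ g > 0, ∀ w ∈ A, dist w m + g ≤ dist w (i m) := by
    rcases A.eq_empty_or_nonempty with rfl | hA
    · exact ⟨1, one_pos, by simp⟩
    · obtain ⟨w₀, h₀, hmin⟩ := hAc.exists_isMinOn hA
        (f := fun w => dist w (i m) - dist w m) (by fun_prop)
      refine ⟨dist w₀ (i m) - dist w₀ m, sub_pos.2 (G.dist_lt_inversion I hm hρs
        (hAm h₀) fun e => hxA (e ▸ h₀)), fun w hw => ?_⟩
      have : dist w₀ (i m) - dist w₀ m ≤ dist w (i m) - dist w m := hmin hw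
      linarith
  obtain ⟨κ, hκ, hκs⟩ : ∃ κ > 0, sph → ρ + κ < Real.pi / 2 := by
    by_cases hs : sph
    · exact ⟨(Real.pi / 2 - ρ) / 2, by linarith [hρs hs], fun _ => by linarith [hρs hs]⟩
    · exact ⟨1, one_pos, fun h => absurd h hs⟩
  obtain ⟨t, ht0, ht1, ht2, ht3, ht4⟩ : ∃ t > 0, t < ρ ∧ t ≤ g / 2 ∧ t ≤ κ ∧ t ≤ dist m u := by
    have := dist_pos.2 hmu
    refine ⟨min (min (ρ / 2) (g / 2)) (min κ (dist m u)), by positivity, ?_, ?_, ?_, ?_⟩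
    · exact ((min_le_left _ _).trans (min_le_left _ _)).trans_lt (by linarith)
    · exact (min_le_left _ _).trans (min_le_right _ _)
    · exact (min_le_right _ _).trans (min_le_left _ _)
    · exact (min_le_right _ _).trans (min_le_right _ _)
  obtain ⟨v, hvb, hv⟩ := G.point m u ht0.le ht4
  have hxv : dist x v ≤ ρ + t := by linarith [dist_triangle x m v]
  have hvx : v ≠ x := by
    rintro rfl
    rw [dist_comm] at hv
    linarith
  have hvs : sph → dist x v < Real.pi / 2 := fun h => by linarith [hκs h]
  have hlt : sph → dist m u < Real.pi := fun h => by
    linarith [dist_triangle m x u, hρs h, hus h, dist_comm m x]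
  refine ⟨v, hvx, hvs, ?_, fun heq => ?_⟩
  · rintro w (hw | hw)
    · have h1 : m ∈ nearSide w (i w) := by
        have := hKm hw
        simp only [nearSide, mem_ofPred_eq] at this ⊢
        rwa [dist_comm m w, I.dist_apply m w, dist_comm (i m)]
      have h2 : u ∈ nearSide w (i w) := by
        have := hKu hw
        simp only [nearSide, mem_ofPred_eq] at this ⊢
        rwa [dist_comm u w, I.dist_apply u w, dist_comm (i u)]
      have := G.gconvex_nearSide w (i w) m h1 u h2 v (G.uniqueBtwPt hvb hlt)
      simp only [nearSide, mem_ofPred_eq] at this ⊢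
      rwa [dist_comm w v, I.dist_apply w v, dist_comm (i w)]
    · have h1 := hgA w hw
      have h2 := dist_triangle w m v
      have h3 := dist_triangle w (i v) (i m)
      rw [i.isometry.dist_eq, dist_comm v m] at h3
      simp only [nearSide, mem_ofPred_eq]
      linarith
  · have hms : sph → dist x m ≤ Real.pi / 2 := fun h => hm ▸ (hρs h).le
    obtain ⟨σ, hσm, hf, H⟩ := G.exists_mirrorSide (I.apply_ne hmx hms).symm
    have hσx : σ x = x := hf x (I.dist_map m).symm
    have hball : closedBall v (dist v x) ⊆ nearSide m (i m) := by
      rw [← heq]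
      exact ball_subset_nearSide I (dist_comm x v) fun h => by
        rw [dist_comm]; exact (hvs h).le
    have hσv := (G.tangent_eq H I hσx (dist_pos.2 hvx) rfl
      (fun h => by rw [dist_comm]; exact (hvs h).le) hball).1
    have hmv : m ≠ v := dist_pos.1 (hv ▸ ht0)
    have hσu : σ u = i u := by
      have b1 := hvb.map σ
      rw [hσm, hσv] at b1
      refine G.nonbranching (i m) (i v) _ _ (i.injective.ne hmv) b1 (hvb.map i) ?_
      rw [← hσv, σ.isometry.dist_eq, hσv, i.isometry.dist_eq]
    have hiu := I.apply_ne hux fun h => (hus h).le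
    by_cases hu : u ∈ nearSide m (i m)
    · apply hne
      rw [← hσu]
      exact G.eq_nearSide H hu (hσu ▸ hiu)
    · have hu' := H.map_mem hu
      have hσσ : σ (σ u) = u := H.inv u
      have hP := G.eq_nearSide H hu' (by rw [hσσ, hσu]; exact hiu.symm)
      rw [hσσ, hσu] at hP
      obtain ⟨c, hc⟩ := hKi
      obtain ⟨r, hr, hb⟩ := Metric.nhds_basis_closedBall.mem_iff.1
        (mem_interior_iff_mem_nhds.1 hc)
      refine G.not_fixed_ball H hr fun w hw => H.fixed w (hKm (hb hw)) ?_
      have h1 := hKu (hb hw)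
      rw [hP]
      simp only [nearSide, mem_ofPred_eq] at h1 ⊢
      rw [← hσu, σ.isometry.dist_eq, H.dist_map w u, hσu]
      exact h1

theorem Geo.eq_of_touching (G : Geo X sph) {p m x w : X} {R ρ : ℝ} (hpm : dist p m = ρ - R)
    (hR : R < ρ) (hx : dist x p = R) (hxm : dist x m = ρ) (hw : dist w p ≤ R)
    (hwm : dist w m = ρ) : w = x := by
  have h := dist_triangle w p m
  have hne : m ≠ p := by
    rintro rfl
    rw [dist_self] at hpm
    linarith
  refine G.nonbranching m p w x hne ?_ ?_ ?_
  · exact Btw.symm (Btw.of_le (by linarith))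
  · exact Btw.symm (Btw.of_le (by linarith))
  · rw [dist_comm p w, dist_comm p x]
    linarith

/-- The common consequence of both symmetry conditions that is used: the ends of the convex hull
near its unique diameter are congruent. -/
def CongruentEnds (d : ℕ) (K L : Set X) : Prop :=
  ∃ δ > (0 : ℝ), ∀ φ ψ : X ≃ᵢ X, GoodPair d K L φ ψ →
    ∀ x ∈ frontier K, ∀ y ∈ frontier L,
      BigDiam d X (hullUnion K L φ ψ) δ →
      UniqueDiametral (hullUnion K L φ ψ) (φ x) (ψ y) →
      ∃ ε₀ > (0 : ℝ), ∀ ε : ℝ, 0 < ε → ε < ε₀ →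
        ∃ σ : X ≃ᵢ X, σ (φ x) = ψ y ∧
          σ '' (hullUnion K L φ ψ ∩ segCyl (φ x) (ψ y) ε) =
            hullUnion K L φ ψ ∩ segCyl (φ x) (ψ y) ε

theorem image_refl (K : Set X) : IsometryEquiv.refl X '' K = K := image_id K

theorem exists_radius {d : ℕ} {R R' δ : ℝ} (hR : IsSphereSpace X d → R < Real.pi / 2)
    (hR' : IsSphereSpace X d → R' < Real.pi / 2) (hδ : 0 < δ) :
    ∃ ρ, R < ρ ∧ R' < ρ ∧ (IsSphereSpace X d → ρ < Real.pi / 2 ∧ Real.pi - δ < 2 * ρ) ∧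
      (¬ IsSphereSpace X d → 1 / δ < 2 * ρ) := by
  by_cases hs : IsSphereSpace X d
  · obtain ⟨ρ, h1, h2⟩ := exists_between
      (max_lt (max_lt (hR hs) (hR' hs)) (by linarith : (Real.pi - δ) / 2 < Real.pi / 2))
    rw [max_lt_iff, max_lt_iff] at h1
    exact ⟨ρ, h1.1.1, h1.1.2, fun _ => ⟨h2, by linarith [h1.2]⟩, fun h => absurd hs h⟩
  · obtain ⟨ρ, h1⟩ := exists_gt (max (max R R') (1 / δ / 2))
    rw [max_lt_iff, max_lt_iff] at h1
    exact ⟨ρ, h1.1.1, h1.1.2, fun h => absurd h hs, fun _ => by linarith [h1.2]⟩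

theorem uniqueDiametral_of_ball {M : Set X} {m x b : X} {ρ : ℝ} (hρ : 0 < ρ)
    (hM : M ⊆ closedBall m ρ) (hsph : ∀ w ∈ M, dist w m = ρ → w = x ∨ w = b)
    (hx : x ∈ M) (hb : b ∈ M) (hd : dist x b = 2 * ρ) :
    diam M = 2 * ρ ∧ UniqueDiametral M x b := by
  have hdiam : diam M = 2 * ρ := by
    refine le_antisymm (diam_le_of_subset_closedBall hρ.le hM) ?_
    rw [← hd]
    exact dist_le_diam_of_mem (isBounded_closedBall.subset hM) hx hb
  refine ⟨hdiam, hx, hb, dist_pos.1 (by linarith), by rw [hd, hdiam], fun a' ha' b' hb' h => ?_⟩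
  rw [hdiam] at h
  have h1 := mem_closedBall.1 (hM ha')
  have h2 := mem_closedBall.1 (hM hb')
  have h3 := dist_triangle a' m b'
  rw [dist_comm m b'] at h3
  have hne : a' ≠ b' := dist_pos.1 (by linarith)
  rcases hsph a' ha' (by linarith) with rfl | rfl <;>
    rcases hsph b' hb' (by linarith) with rfl | rfl
  · exact absurd rfl hne
  · exact Or.inl ⟨rfl, rfl⟩
  · exact Or.inr ⟨rfl, rfl⟩
  · exact absurd rfl hne

theorem Geo.eq_supporting {d : ℕ} (G : Geo X (IsSphereSpace X d)) {K L : Set X}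
    (hK : IsClosed K) (hKi : (interior K).Nonempty)
    (hL : IsClosed L) (hLi : (interior L).Nonempty) (hLne : L ≠ univ)
    (hLs : SupportingSpheres d L) (hC : CongruentEnds d K L)
    {x p : X} {R : ℝ} {i : X ≃ᵢ X} (I : PointInversion (IsSphereSpace X d) x i)
    (hx : x ∈ frontier K) (hR : 0 < R) (hKp : K ⊆ closedBall p R) (hxp : dist x p = R)
    (hRs : IsSphereSpace X d → R < Real.pi / 2)
    {P : Set X} (hP : IsHalfspace P) (hKP : K ⊆ P) (hxP : x ∈ frontier P) :
    P = nearSide p (i p) := by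
  have := G.proper
  obtain ⟨y, hy, z, r, hr, hzL, hzy⟩ := G.exists_tangent_ball hL hLi hLne
  obtain ⟨q, R', hR', hLq, hyq, hR's⟩ := hLs y hy
  rw [mem_sphere] at hyq
  obtain ⟨δ, hδ, hC⟩ := hC
  obtain ⟨ρ, hRρ, hR'ρ, hρs, hρn⟩ := exists_radius hRs hR's hδ
  have hρ : 0 < ρ := hR.trans hRρ
  have hρπ : IsSphereSpace X d → ρ < Real.pi / 2 := fun h => (hρs h).1
  have hxp' : x ≠ p := dist_pos.1 (by rwa [hxp])
  obtain ⟨γ, hγ0, hγR, hγ⟩ := G.line x p hxp'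
  rw [hxp] at hγR
  have hγd : ∀ s t, 0 ≤ s → s ≤ t → t ≤ 2 * ρ → dist (γ s) (γ t) = t - s := by
    intro s t h0 hst ht
    have e : |s - t| = t - s := by rw [abs_sub_comm, abs_of_nonneg (by linarith)]
    rw [hγ s t (fun h => by rw [e]; linarith [hρπ h]), e]
  set m := γ ρ with hm_def
  set b := γ (2 * ρ) with hb_def
  set q' := γ (2 * ρ - R') with hq_def
  have hxm : dist x m = ρ := by
    rw [← hγ0, hm_def, hγd 0 ρ le_rfl hρ.le (by linarith), sub_zero]
  have hmb : dist m b = ρ := by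
    rw [hm_def, hb_def, hγd ρ (2 * ρ) hρ.le (by linarith) le_rfl]
    ring
  have hxb : dist x b = 2 * ρ := by
    rw [← hγ0, hb_def, hγd 0 (2 * ρ) le_rfl (by linarith) le_rfl, sub_zero]
  have hpm : dist p m = ρ - R := by
    rw [← hγR, hm_def, hγd R ρ hR.le hRρ.le (by linarith)]
  have hqm : dist q' m = ρ - R' := by
    rw [dist_comm, hm_def, hq_def, hγd ρ (2 * ρ - R') hρ.le (by linarith) (by linarith)]
    ring
  have hqb : dist b q' = R' := by
    rw [dist_comm, hb_def, hq_def, hγd (2 * ρ - R') (2 * ρ) (by linarith) (by linarith) le_rfl]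
    ring
  have hxq : dist x q' = 2 * ρ - R' := by
    rw [← hγ0, hq_def, hγd 0 (2 * ρ - R') le_rfl (by linarith) (by linarith), sub_zero]
  have hmx : m ≠ x := (dist_pos.1 (by rwa [hxm])).symm
  obtain ⟨ψ, hψ, hψy, hψq⟩ := G.exists_orientationPreserving (hyq.trans hqb.symm)
  have hKm : closedBall p R ⊆ closedBall m ρ := closedBall_subset_closedBall' (by linarith)
  have hLψ : ψ '' L ⊆ closedBall q' R' := by
    rintro _ ⟨w, hw, rfl⟩
    rw [mem_closedBall, ← hψq, ψ.isometry.dist_eq]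
    exact hLq hw
  have hLm : ψ '' L ⊆ closedBall m ρ :=
    hLψ.trans (closedBall_subset_closedBall' (by linarith))
  set M := hullUnion K L (IsometryEquiv.refl X) ψ with hM_def
  have hM_eq : M = gconvexHull (K ∪ ψ '' L) := by
    rw [hM_def, hullUnion, image_refl]
  have hKM : K ⊆ M := hM_eq ▸ subset_union_left.trans (subset_gconvexHull _)
  have hLM : ψ '' L ⊆ M := hM_eq ▸ subset_union_right.trans (subset_gconvexHull _)
  have hKLm : K ∪ ψ '' L ⊆ closedBall m ρ := union_subset (hKp.trans hKm) hLm
  have hMm : M ⊆ closedBall m ρ := hM_eq ▸ gconvexHull_subset (G.gconvex_closedBall hρπ) hKLm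
  have hMsph : ∀ w ∈ M, dist w m = ρ → w = x ∨ w = b := by
    intro w hw hwm
    by_contra hcon
    push Not at hcon
    have hsub : K ∪ ψ '' L ⊆ closedBall m ρ \ {w} := by
      refine fun v hv => ⟨hKLm hv, ?_⟩
      rintro rfl
      rcases hv with h | h
      · exact hcon.1 (G.eq_of_touching hpm hRρ hxp hxm (hKp h) hwm)
      · exact hcon.2 (G.eq_of_touching hqm hR'ρ hqb (by rw [dist_comm, hmb]) (hLψ h) hwm)
    rw [hM_eq] at hw
    exact (gconvexHull_subset (G.gconvex_closedBall_diff hρπ hwm) hsub hw).2 rfl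
  have hxK : x ∈ K := hK.frontier_subset hx
  have hbL : b ∈ ψ '' L := ⟨y, hL.frontier_subset hy, hψy⟩
  obtain ⟨hdiam, hU⟩ := uniqueDiametral_of_ball hρ hMm hMsph (hKM hxK) (hLM hbL) hxb
  obtain ⟨ε₀, hε₀, hσ⟩ := hC (IsometryEquiv.refl X) ψ
    ⟨orientationPreserving_refl, hψ, fun h => ⟨m, by
      rw [image_refl]
      exact hKLm.trans (closedBall_subset_ball (hρπ h))⟩⟩ x hx y hy
    ⟨fun h => by rw [hdiam]; exact (hρs h).2, fun h => by rw [hdiam]; exact hρn h⟩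
    (by rw [hψy]; exact hU)
  have hπ := Real.pi_pos
  have hmin : 0 < min (ε₀ / 2) (Real.pi / 4) := by positivity
  set ε := min (ε₀ / 2) (Real.pi / 4) with hε_def
  obtain ⟨σ, hσx, hσS⟩ := hσ ε hmin ((min_le_left _ _).trans_lt (by linarith))
  rw [hψy] at hσx hσS
  change σ x = b at hσx
  change σ '' (M ∩ segCyl x b ε) = M ∩ segCyl x b ε at hσS
  obtain ⟨η, hη, hcyl⟩ := G.exists_nhds_subset_segCyl (a := b) (b := x) hρ
    (by rw [dist_comm, hmb]) (by rw [dist_comm, hxm]) (by rw [dist_comm, hxb]) hρπ hmin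
    (fun _ => min_le_right _ _)
  rw [segCyl_comm] at hcyl
  obtain ⟨r', hr', hr'r, hr'η, hr'1⟩ : ∃ r' > 0, r' ≤ r ∧ r' ≤ η / 3 ∧ r' ≤ 1 :=
    ⟨min r (min (η / 3) 1), by positivity, min_le_left _ _,
      (min_le_right _ _).trans (min_le_left _ _), (min_le_right _ _).trans (min_le_right _ _)⟩
  have hbz : dist b (ψ z) = r := by rw [← hψy, ψ.isometry.dist_eq, dist_comm, hzy]
  obtain ⟨z', hz'b, hz'⟩ := G.point b (ψ z) hr'.le (hr'r.trans hbz.ge)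
  have hz'z : dist z' (ψ z) = r - r' := by
    have : _ + _ = _ := hz'b
    linarith
  have hz'L : closedBall z' r' ⊆ ψ '' L := by
    intro w hw
    have h1 : w ∈ closedBall (ψ z) r := closedBall_subset_closedBall' (by linarith) hw
    refine ⟨ψ.symm w, hzL ?_, ψ.apply_symm_apply w⟩
    rw [mem_closedBall, ← ψ.isometry.dist_eq, ψ.apply_symm_apply]
    exact h1
  have hz'S : closedBall z' r' ⊆ M ∩ segCyl x b ε := by
    intro w hw
    refine ⟨hLM (hz'L hw), hcyl w ?_ (hLm (hz'L hw))⟩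
    have := dist_triangle w z' b
    rw [dist_comm z' b, hz'] at this
    linarith [mem_closedBall.1 hw]
  set c := σ.symm z' with hc_def
  have hσc : σ c = z' := σ.apply_symm_apply z'
  have hcM : closedBall c r' ⊆ M := by
    intro w hw
    have h1 : σ w ∈ closedBall z' r' := by
      rw [mem_closedBall, ← hσc, σ.isometry.dist_eq]
      exact hw
    have h2 := hz'S h1
    rw [← hσS] at h2
    obtain ⟨v, hv, hvw⟩ := h2
    exact σ.injective hvw ▸ hv.1
  have hcx : dist c x = r' := by rw [← σ.isometry.dist_eq, hσc, hσx, dist_comm, hz']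
  have hr's : IsSphereSpace X d → r' ≤ Real.pi / 2 := fun _ => by linarith [one_lt_half_pi]
  have key : ∀ v, v ≠ x → (IsSphereSpace X d → dist x v < Real.pi / 2) →
      K ∪ ψ '' L ⊆ nearSide v (i v) → nearSide v (i v) = nearSide c (i c) := by
    intro v hvx hvs hKv
    obtain ⟨s, -, hf, H⟩ := G.exists_mirrorSide (I.apply_ne hvx fun h => (hvs h).le).symm
    refine (G.tangent_eq H I (hf x (I.dist_map v).symm) hr' hcx hr's (hcM.trans ?_)).2
    rw [hM_eq]
    exact gconvexHull_subset (G.gconvex_nearSide _ _) hKv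
  have hms : IsSphereSpace X d → dist x m < Real.pi / 2 := fun h => hxm ▸ hρπ h
  have hball := ball_subset_nearSide I hxm fun h => (hρπ h).le
  have hmp : nearSide m (i m) = nearSide p (i p) := by
    obtain ⟨s, -, hf, H⟩ := G.exists_mirrorSide (I.apply_ne hmx fun h => (hms h).le).symm
    exact (G.tangent_eq H I (hf x (I.dist_map m).symm) hR (by rw [dist_comm, hxp])
      (fun h => (hRs h).le) (hKm.trans hball)).2
  obtain ⟨τ, H⟩ := hP.mirrorSide
  obtain ⟨u, hux, hus, -, rfl⟩ := G.exists_eq_nearSide H (H.fixed_of_frontier hxP) I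
  by_contra hne
  have hcomp : IsCompact (ψ '' L) := by
    refine ((isCompact_closedBall q R').of_isClosed_subset hL hLq).image ψ.continuous
  have hxL : x ∉ ψ '' L := fun h => by
    have := mem_closedBall.1 (hLψ h)
    linarith
  obtain ⟨v, hvx, hvs, hKv, hvne⟩ := G.exists_tilted_side I hρ hxm hρπ hux hus
    ((hKp.trans hKm).trans hball) hKP (hmp ▸ Ne.symm hne) hKi hcomp hLm hxL
  exact hvne ((key v hvx hvs hKv).trans (key m hmx hms (hKLm.trans hball)).symm)

theorem Geo.smoothBody {d : ℕ} (G : Geo X (IsSphereSpace X d)) {K L : Set X}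
    (hK : IsClosed K) (hKi : (interior K).Nonempty)
    (hL : IsClosed L) (hLi : (interior L).Nonempty) (hLne : L ≠ univ)
    (hKs : SupportingSpheres d K) (hLs : SupportingSpheres d L) (hC : CongruentEnds d K L) :
    SmoothBody K := by
  intro x hx
  obtain ⟨p, R, hR, hKp, hxp, hRs⟩ := hKs x hx
  obtain ⟨i, I⟩ := G.inversion x
  obtain ⟨h1, h2, h3⟩ := G.supporting_nearSide I hR hxp hRs
  exact ⟨nearSide p (i p), ⟨h1, hKp.trans h2, h3⟩, fun P hP =>
    G.eq_supporting hK hKi hL hLi hLne hLs hC I hx hR hKp hxp hRs hP.1 hP.2.1 hP.2.2⟩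

theorem UniqueDiametral.symm {M : Set X} {a b : X} (h : UniqueDiametral M a b) :
    UniqueDiametral M b a := by
  obtain ⟨ha, hb, hab, hd, hu⟩ := h
  exact ⟨hb, ha, hab.symm, by rwa [dist_comm], fun a' ha' b' hb' e => (hu a' ha' b' hb' e).symm⟩

theorem hullUnion_comm (K L : Set X) (φ ψ : X ≃ᵢ X) :
    hullUnion K L φ ψ = hullUnion L K ψ φ := by
  rw [hullUnion, hullUnion, union_comm]

theorem CongruentEnds.symm {d : ℕ} {K L : Set X} (h : CongruentEnds d K L) :
    CongruentEnds d L K := by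
  obtain ⟨δ, hδ, h⟩ := h
  refine ⟨δ, hδ, fun φ ψ hg x hx y hy hb hu => ?_⟩
  rw [hullUnion_comm] at hb hu
  obtain ⟨ε₀, hε₀, hσ⟩ := h ψ φ ⟨hg.2.1, hg.1, fun hs => by
    rw [union_comm]; exact hg.2.2 hs⟩ y hy x hx hb hu.symm
  refine ⟨ε₀, hε₀, fun ε h0 h1 => ?_⟩
  obtain ⟨σ, hσ1, hσ2⟩ := hσ ε h0 h1
  rw [hullUnion_comm, segCyl_comm]
  refine ⟨σ.symm, by rw [← hσ1, σ.symm_apply_apply], ?_⟩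
  conv_lhs => rw [← hσ2, ← image_comp]
  simp

theorem T7Cond6.congruentEnds {d : ℕ} {K L : Set X} (h : T7Cond6 d K L) :
    CongruentEnds d K L := by
  obtain ⟨δ, hδ, h⟩ := h
  refine ⟨δ, hδ, fun φ ψ hg x hx y hy hb hu => ?_⟩
  obtain ⟨ε₀, hε₀, hσ⟩ := h φ ψ hg x hx y hy hb hu
  refine ⟨ε₀, hε₀, fun ε h0 h1 => ?_⟩
  obtain ⟨σ, -, h2, h3⟩ := (hσ ε h0 h1).2
  exact ⟨σ, h2, h3⟩

theorem T7Cond5.congruentEnds {d : ℕ} {K L : Set X} (h : T7Cond5 d K L) :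
    CongruentEnds d K L := by
  obtain ⟨δ, hδ, h⟩ := h
  refine ⟨δ, hδ, fun φ ψ hg x hx y hy hb hu => ?_⟩
  obtain ⟨ε₀, hε₀, hσ⟩ := h φ ψ hg x hx y hy hb hu
  refine ⟨ε₀, hε₀, fun ε h0 h1 => ?_⟩
  obtain ⟨σ, p, hinv, hp, hS, hmid⟩ := (hσ ε h0 h1).2
  refine ⟨σ, ?_, hS⟩
  obtain ⟨ha, hb', hab, hd, huniq⟩ := hu
  have haS := And.intro ha (left_mem_segCyl (φ x) (ψ y) h0.le)
  have hbS := And.intro hb' (segCyl_comm (ψ y) (φ x) ε ▸ left_mem_segCyl (ψ y) (φ x) h0.le)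
  have hmem : ∀ w ∈ hullUnion K L φ ψ ∩ segCyl (φ x) (ψ y) ε, σ w ∈ hullUnion K L φ ψ :=
    fun w hw => ((hS ▸ mem_image_of_mem σ hw :
      σ w ∈ hullUnion K L φ ψ ∩ segCyl (φ x) (ψ y) ε)).1
  rcases huniq (σ (φ x)) (hmem _ haS) (σ (ψ y)) (hmem _ hbS)
    (by rw [σ.isometry.dist_eq, hd]) with h | h
  · have e1 := hmid _ haS
    have e2 := hmid _ hbS
    rw [h.1] at e1
    rw [h.2] at e2
    simp only [IsMidpoint, Btw, dist_self] at e1 e2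
    have f1 : dist (φ x) p = 0 := by linarith [e1.1, e1.2]
    have f2 : dist (ψ y) p = 0 := by linarith [e2.1, e2.2]
    exact absurd ((dist_eq_zero.1 f1).trans (dist_eq_zero.1 f2).symm) hab
  · exact h.1

/-- The metric space `X` realized as a quadric `B v v = 1` in a real vector space with a
bilinear form, the form being the generalized cosine `C` of the distance. -/
structure QuadricModel (sph : Prop) {V : Type*} [AddCommGroup V] [Module ℝ V]
    (B : V →ₗ[ℝ] V →ₗ[ℝ] ℝ) (e : X → V) (C S : ℝ → ℝ) (ε : ℝ) : Prop where
  symm : ∀ u v, B u v = B v u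
  injective : Function.Injective e
  self : ∀ x, B (e x) (e x) = 1
  pair : ∀ x y, B (e x) (e y) = C (dist x y)
  dist_le : sph → ∀ x y : X, dist x y ≤ Real.pi
  sq : ∀ t, C t * C t + ε * (S t * S t) = 1
  C_sub : ∀ s t, C (s - t) = C s * C t + ε * (S s * S t)
  C_add : ∀ s t, C (s + t) = C s * C t - ε * (S s * S t)
  S_add : ∀ s t, S (s + t) = S s * C t + C s * S t
  C_zero : C 0 = 1
  C_inj : ∀ s t, 0 ≤ s → 0 ≤ t → (sph → s ≤ Real.pi) → (sph → t ≤ Real.pi) → C s = C t → s = t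
  C_abs : ∀ t, C |t| = C t
  C_pos : ¬ sph → ∀ t, 0 < C t
  S_ne : ∀ t, 0 < t → (sph → t < Real.pi) → S t ≠ 0
  definite : ∀ x v, B (e x) v = 0 → B v v = 0 → v = 0
  mem_range : ∀ v, B v v = 1 → (sph ∨ ∃ x, 0 < B (e x) v) → v ∈ range e
  normal : ∀ x y, ∃ n, B (e x) n = 0 ∧ B (e y) n = 0 ∧ B n n = ε

namespace QuadricModel

variable {V : Type*} [AddCommGroup V] [Module ℝ V] {B : V →ₗ[ℝ] V →ₗ[ℝ] ℝ} {e : X → V}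
  {C S : ℝ → ℝ} {ε : ℝ}

theorem dist_eq (M : QuadricModel sph B e C S ε) {x y : X} {t : ℝ} (h0 : 0 ≤ t)
    (h1 : sph → t ≤ Real.pi) (h : B (e x) (e y) = C t) : dist x y = t :=
  M.C_inj _ _ dist_nonneg h0 (fun hs => M.dist_le hs x y) h1 (by rw [← M.pair, h])

theorem exists_lift (M : QuadricModel sph B e C S ε) (f : V → V)
    (hB : ∀ a b, B (f a) (f b) = B a b) (hf : Function.Involutive f) {x y : X}
    (hxy : f (e x) = e y) :
    ∃ σ : X ≃ᵢ X, Function.Involutive σ ∧ ∀ w, e (σ w) = f (e w) := by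
  have hr : ∀ w, ∃ w', e w' = f (e w) := by
    refine fun w => M.mem_range _ (by rw [hB, M.self]) ?_
    by_cases hs : sph
    · exact Or.inl hs
    · refine Or.inr ⟨y, ?_⟩
      rw [← hxy, hB, M.pair]
      exact M.C_pos hs _
  choose σ hσ using hr
  have hinv : Function.Involutive σ := fun w => M.injective (by rw [hσ, hσ, hf])
  refine ⟨⟨hinv.toPerm, Isometry.of_dist_eq fun a b => ?_⟩, hinv, hσ⟩
  refine M.dist_eq dist_nonneg (fun hs => M.dist_le hs a b) ?_
  change B (e (σ a)) (e (σ b)) = _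
  rw [hσ, hσ, hB, M.pair]

theorem exists_curve (M : QuadricModel sph B e C S ε) {x : X} {n : V} (h : B (e x) n = 0)
    (hn : B n n = ε) : ∃ γ : ℝ → X, (∀ t, e (γ t) = C t • e x + S t • n) ∧
      ∀ s t, (sph → |s - t| ≤ Real.pi) → dist (γ s) (γ t) = |s - t| := by
  have hB : ∀ s t, B (C s • e x + S s • n) (C t • e x + S t • n) =
      C s * C t + ε * (S s * S t) := by
    intro s t
    simp only [map_add, map_smul, LinearMap.add_apply, LinearMap.smul_apply, smul_eq_mul,
      M.self, h, M.symm n (e x), hn]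
    ring
  have hr : ∀ t, ∃ w, e w = C t • e x + S t • n := by
    refine fun t => M.mem_range _ (by rw [hB, M.sq]) ?_
    by_cases hs : sph
    · exact Or.inl hs
    · refine Or.inr ⟨x, ?_⟩
      simpa [M.self, h] using M.C_pos hs t
  choose γ hγ using hr
  refine ⟨γ, hγ, fun s t hst => M.dist_eq (abs_nonneg _) hst ?_⟩
  rw [hγ, hγ, hB, M.C_abs, M.C_sub]

theorem exists_direction (M : QuadricModel sph B e C S ε) (x y : X) :
    ∃ n, B (e x) n = 0 ∧ B n n = ε ∧ e y = C (dist x y) • e x + S (dist x y) • n := by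
  have hsq := M.sq (dist x y)
  have h1 : B (e x) (e y - C (dist x y) • e x) = 0 := by
    simp [M.self, M.pair]
  have h2 : B (e y - C (dist x y) • e x) (e y - C (dist x y) • e x) =
      ε * (S (dist x y) * S (dist x y)) := by
    simp only [map_sub, map_smul, LinearMap.sub_apply, LinearMap.smul_apply, smul_eq_mul,
      M.self, M.symm (e y) (e x), M.pair x y]
    linarith
  by_cases hS : S (dist x y) = 0
  · obtain ⟨n, hn, -, hnn⟩ := M.normal x x
    refine ⟨n, hn, hnn, ?_⟩
    rw [hS, mul_zero, mul_zero] at h2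
    rw [hS, zero_smul, add_zero]
    exact sub_eq_zero.1 (M.definite x _ h1 h2)
  · refine ⟨(S (dist x y))⁻¹ • (e y - C (dist x y) • e x), ?_, ?_, ?_⟩
    · rw [map_smul, h1, smul_zero]
    · simp only [map_smul, LinearMap.smul_apply, h2, smul_eq_mul]
      field_simp
    · rw [smul_smul, mul_inv_cancel₀ hS, one_smul]
      abel

theorem btw_relation (M : QuadricModel sph B e C S ε) {w c z : X} (h : Btw w c z) :
    S (dist w c) • e z =
      S (dist w c + dist c z) • e c - S (dist c z) • e w := by
  have hB : dist w c + dist c z = dist w z := h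
  have hC := M.pair w z
  rw [← hB, M.C_add] at hC
  have hwc := M.pair w c
  have hcz := M.pair c z
  have hs1 := M.sq (dist w c)
  have hs2 := M.sq (dist c z)
  rw [M.S_add]
  generalize dist w c = a at *
  generalize dist c z = b at *
  refine sub_eq_zero.1 (M.definite c _ ?_ ?_)
  · simp only [map_sub, map_smul, smul_eq_mul, M.self, hcz, M.symm (e c) (e w), hwc]
    ring
  · simp only [map_sub, map_smul, LinearMap.sub_apply, LinearMap.smul_apply, smul_eq_mul,
      M.self, M.symm (e c) (e w), M.symm (e z) (e w), M.symm (e z) (e c), hwc, hcz, hC]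
    linear_combination (-(S a * S a)) * hs2 - (S b * S b) * hs1

theorem geo [ProperSpace X] (M : QuadricModel sph B e C S ε) : Geo X sph where
  proper := inferInstance
  dist_le := M.dist_le
  line x y _ := by
    obtain ⟨n, h1, h2, h3⟩ := M.exists_direction x y
    obtain ⟨γ, hγ, hd⟩ := M.exists_curve h1 h2
    have hS : S 0 = 0 := by
      have := M.S_add 0 0
      rw [M.C_zero, add_zero] at this
      linarith
    exact ⟨γ, M.injective (by simp [hγ, M.C_zero, hS]), M.injective (by rw [hγ, h3]), hd⟩
  nonbranching w c z z' hwc h h' hd := by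
    by_cases hS : S (dist w c) = 0
    · have hs : sph ∧ Real.pi ≤ dist w c := by
        by_contra hcon
        push Not at hcon
        exact M.S_ne _ (dist_pos.2 hwc) hcon hS
      have e1 : _ + _ = _ := h
      have hz : dist c z = 0 :=
        le_antisymm (by linarith [M.dist_le hs.1 w z, hs.2]) dist_nonneg
      exact (dist_eq_zero.1 hz).symm.trans (dist_eq_zero.1 (hd ▸ hz))
    · have e1 := M.btw_relation h
      have e2 := M.btw_relation h'
      rw [← hd, ← e1] at e2
      exact M.injective (smul_right_injective V hS e2.symm)
  swap u v huv := by
    set n := e u - e v with hn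
    have hnn : B n n = 2 - 2 * B (e u) (e v) := by
      simp only [hn, map_sub, LinearMap.sub_apply, M.self, M.symm (e v) (e u)]
      ring
    have hne : B n n ≠ 0 := by
      intro h0
      refine huv (dist_eq_zero.1 (M.dist_eq le_rfl (fun _ => Real.pi_pos.le) ?_))
      rw [M.C_zero]
      linarith
    have hun : B (e u) n = B n n / 2 := by
      rw [hnn, hn, map_sub, M.self]
      ring
    obtain ⟨σ, hinv, hσ⟩ := M.exists_lift (fun w => w - (2 * B w n / B n n) • n) (x := u) (y := v)
      (fun a b => by
        simp only [map_sub, map_smul, LinearMap.sub_apply, LinearMap.smul_apply, smul_eq_mul,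
          M.symm n b]
        field_simp
        ring)
      (fun a => by
        simp only [map_sub, map_smul, LinearMap.sub_apply, LinearMap.smul_apply, smul_eq_mul]
        rw [sub_sub, ← add_smul]
        convert sub_zero a
        convert zero_smul ℝ n
        field_simp
        ring)
      (by
        simp only [hun]
        rw [show 2 * (B n n / 2) / B n n = 1 by field_simp, one_smul, hn]
        abel)
    refine ⟨σ, hinv, M.injective ?_, fun w hw => M.injective ?_⟩
    · rw [hσ, hun, show 2 * (B n n / 2) / B n n = 1 by field_simp, one_smul, hn]
      abel
    · have : B (e w) n = 0 := by rw [hn, map_sub, M.pair, M.pair, hw, sub_self]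
      rw [hσ, this]
      simp
  equidistant u v := by
    obtain ⟨n, h1, h2, h3⟩ := M.normal u v
    obtain ⟨γ, hγ, hd⟩ := M.exists_curve h1 h3
    have hC : C (-1) = C 1 := by rw [← M.C_abs (-1), abs_neg, abs_one]
    have key : ∀ w, B (e w) n = 0 → dist w (γ 1) = dist w (γ (-1)) := by
      intro w hw
      refine M.dist_eq dist_nonneg (fun hs => M.dist_le hs _ _) ?_
      rw [← M.pair, hγ, hγ, hC]
      simp [hw]
    refine ⟨γ 1, γ (-1), fun h => ?_, key u h1, key v h2⟩
    have := hd 1 (-1) fun _ => by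
      norm_num
      linarith [Real.pi_gt_three]
    rw [h, dist_self] at this
    norm_num at this
  inversion x := by
    obtain ⟨σ, hinv, hσ⟩ := M.exists_lift (fun w => (2 * B (e x) w) • e x - w) (x := x) (y := x)
      (fun a b => by
        simp only [map_sub, map_smul, LinearMap.sub_apply, LinearMap.smul_apply, smul_eq_mul,
          M.self, M.symm a (e x)]
        ring)
      (fun a => by
        simp only [map_sub, map_smul, smul_eq_mul, M.self]
        rw [sub_sub_eq_add_sub, ← sub_add_eq_add_sub, ← sub_smul]
        convert zero_add a
        convert zero_smul ℝ (e x)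
        ring)
      (by
        simp only [M.self]
        rw [mul_one, two_smul]
        abel)
    refine ⟨σ, hinv, M.injective ?_, fun u hu => ?_⟩
    · rw [hσ, M.self, mul_one, two_smul]
      abel
    · refine M.dist_eq (by positivity) (fun hs => by linarith [hu hs]) ?_
      have := M.sq (dist x u)
      rw [hσ, two_mul (dist x u), M.C_add]
      simp only [map_sub, map_smul, smul_eq_mul, M.self, M.pair, dist_comm u x]
      linarith

end QuadricModel

theorem exists_ne_zero_map_eq_zero {V W : Type*} [AddCommGroup V] [Module ℝ V]
    [FiniteDimensional ℝ V] [AddCommGroup W] [Module ℝ W] [FiniteDimensional ℝ W] (f : V →ₗ[ℝ] W)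
    (h : Module.finrank ℝ W < Module.finrank ℝ V) : ∃ n, n ≠ 0 ∧ f n = 0 := by
  obtain ⟨n, hn, h0⟩ := (Submodule.ne_bot_iff _).1 (LinearMap.ker_ne_bot_of_finrank_lt (f := f) h)
  exact ⟨n, h0, hn⟩

theorem exists_ne_zero_apply_eq_zero {V : Type*} [AddCommGroup V] [Module ℝ V]
    [FiniteDimensional ℝ V] (hV : 2 < Module.finrank ℝ V) (f g : V →ₗ[ℝ] ℝ) :
    ∃ n, n ≠ 0 ∧ f n = 0 ∧ g n = 0 := by
  obtain ⟨n, hn, h⟩ := exists_ne_zero_map_eq_zero (f.prod g) (by simpa using hV)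
  exact ⟨n, hn, by simpa using congrArg Prod.fst h, by simpa using congrArg Prod.snd h⟩

/-- Compactness can be checked after an injection through which the distance factors
continuously. -/
theorem isCompact_preimage_of_dist_eq {V : Type*} [TopologicalSpace V] {e : X → V}
    (he : Function.Injective e) {q : ℝ → ℝ} (hq : Continuous q) {F : V → V → ℝ}
    (hF : ∀ v, Continuous fun u => F u v) (hd : ∀ x y, dist x y = q (F (e x) (e y))) {T : Set V}
    (hT : IsCompact T) (hTe : T ⊆ range e) : IsCompact (e ⁻¹' T) := by
  have hr : ∀ t : T, ∃ x, e x = t := fun t => hTe t.2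
  choose g hg using hr
  have : CompactSpace T := isCompact_iff_compactSpace.1 hT
  have hc : Continuous g := by
    refine continuous_iff_continuousAt.2 fun t => tendsto_iff_dist_tendsto_zero.2 ?_
    have h : Tendsto (fun s : T => q (F s t)) (nhds t) (nhds (q (F t t))) :=
      (hq.comp ((hF t).comp continuous_subtype_val)).tendsto t
    have h0 : q (F t t) = 0 := by rw [← hg t, ← hd, dist_self]
    rw [h0] at h
    refine h.congr fun s => ?_
    rw [hd, hg, hg]
  convert isCompact_range hc using 1
  ext x
  refine ⟨fun hx => ⟨⟨e x, hx⟩, he (hg _)⟩, ?_⟩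
  rintro ⟨t, rfl⟩
  rw [mem_preimage, hg]
  exact t.2

theorem IsSphereSpace.geo {d : ℕ} (hd : 2 ≤ d) (hX : IsSphereSpace X d) (hs : sph) :
    Geo X sph := by
  obtain ⟨e, hinj, hrange, hdist⟩ := hX
  have hnorm : ∀ x, ‖e x‖ = 1 := fun x => by
    have : e x ∈ sphere (0 : EuclideanSpace ℝ (Fin (d + 1))) 1 := hrange ▸ mem_range_self x
    simpa using this
  have hproper : ProperSpace X := by
    have hc : IsCompact (univ : Set X) := by
      have := isCompact_preimage_of_dist_eq hinj Real.continuous_arccos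
        (F := fun u v => inner ℝ u v) (fun v => by fun_prop) hdist
        (isCompact_sphere (0 : EuclideanSpace ℝ (Fin (d + 1))) 1) hrange.ge
      rwa [← hrange, preimage_range] at this
    exact ⟨fun x r => hc.of_isClosed_subset isClosed_closedBall (subset_univ _)⟩
  refine QuadricModel.geo (B := innerₗ _) (e := e) (C := Real.cos) (S := Real.sin) (ε := 1)
    { symm := fun u v => real_inner_comm v u
      injective := hinj
      self := fun x => by simp [hnorm]
      pair := fun x y => ?_
      dist_le := fun _ x y => by rw [hdist]; exact Real.arccos_le_pi _
      sq := fun t => by nlinarith [Real.sin_sq_add_cos_sq t]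
      C_sub := fun s t => by rw [Real.cos_sub]; ring
      C_add := fun s t => by rw [Real.cos_add]; ring
      S_add := Real.sin_add
      C_zero := Real.cos_zero
      C_inj := fun s t h0 h1 h2 h3 h => Real.injOn_cos ⟨h0, h2 hs⟩ ⟨h1, h3 hs⟩ h
      C_abs := Real.cos_abs
      C_pos := fun h => absurd hs h
      S_ne := fun t h0 h1 => (Real.sin_pos_of_pos_of_lt_pi h0 (h1 hs)).ne'
      definite := fun x v _ h => by simpa using h
      mem_range := fun v h _ => ?_
      normal := fun x y => ?_ }
  · have h := abs_le.1 (abs_real_inner_le_norm (e x) (e y))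
    rw [hnorm, hnorm, mul_one] at h
    rw [hdist, Real.cos_arccos h.1 h.2]
    rfl
  · rw [hrange, mem_sphere_zero_iff_norm]
    have h2 : ‖v‖ ^ 2 = 1 := by
      rw [← real_inner_self_eq_norm_sq]
      exact h
    exact (pow_eq_one_iff_of_nonneg (norm_nonneg v) two_ne_zero).1 h2
  · obtain ⟨n, hn, h1, h2⟩ := exists_ne_zero_apply_eq_zero
      (by rw [finrank_euclideanSpace_fin]; omega) (innerₗ _ (e x)) (innerₗ _ (e y))
    have hn' : ‖n‖ ≠ 0 := norm_ne_zero_iff.2 hn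
    refine ⟨‖n‖⁻¹ • n, by simp [h1], by simp [h2], ?_⟩
    simp only [map_smul, LinearMap.smul_apply, innerₗ_apply_apply, smul_eq_mul,
      real_inner_self_eq_norm_sq]
    field_simp

theorem mink_self_pos_of_orthogonal {d : ℕ} {x v : EuclideanSpace ℝ (Fin d) × ℝ} (hx : mink d x x = -1)
    (h : mink d x v = 0) (hv : v ≠ 0) : 0 < mink d v v := by
  unfold mink at *
  have hcs := real_inner_mul_inner_self_le x.1 v.1
  have h1 : 0 ≤ inner ℝ v.1 v.1 := real_inner_self_nonneg
  by_contra! hle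
  have h2 : inner ℝ x.1 v.1 = x.2 * v.2 := by linarith
  have h3 : inner ℝ x.1 x.1 = x.2 * x.2 - 1 := by linarith
  rw [h2, h3] at hcs
  have h4 : inner ℝ v.1 v.1 ≤ 0 := by
    nlinarith [mul_nonneg (mul_self_nonneg x.2) (sub_nonneg.2 hle)]
  have h5 : inner ℝ v.1 v.1 = 0 := le_antisymm h4 h1
  have h6 : v.1 = 0 := inner_self_eq_zero.1 h5
  have h7 : x.2 ≠ 0 := by
    intro h0
    have : 0 ≤ inner ℝ x.1 x.1 := real_inner_self_nonneg
    rw [h3, h0] at this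
    linarith
  rw [h6, inner_zero_right] at h2
  exact hv (Prod.ext h6 ((mul_eq_zero.1 h2.symm).resolve_left h7))

/-- The negative of the Minkowski form, as a bilinear map. -/
noncomputable def negMink (d : ℕ) :
    (EuclideanSpace ℝ (Fin d) × ℝ) →ₗ[ℝ] (EuclideanSpace ℝ (Fin d) × ℝ) →ₗ[ℝ] ℝ :=
  LinearMap.mk₂ ℝ (fun u v => -mink d u v)
    (fun u v w => by simp only [mink, Prod.fst_add, Prod.snd_add, inner_add_left]; ring)
    (fun c u v => by
      simp only [mink, Prod.smul_fst, Prod.smul_snd, real_inner_smul_left, smul_eq_mul]; ring)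
    (fun u v w => by simp only [mink, Prod.fst_add, Prod.snd_add, inner_add_right]; ring)
    (fun c u v => by
      simp only [mink, Prod.smul_fst, Prod.smul_snd, real_inner_smul_right, smul_eq_mul]; ring)

theorem negMink_apply {d : ℕ} (u v : EuclideanSpace ℝ (Fin d) × ℝ) :
    negMink d u v = -mink d u v := rfl

/-- On a timelike cone, `-mink x u` controls the time coordinate of `u`. -/
theorem mul_snd_le_neg_mink {d : ℕ} {x u : EuclideanSpace ℝ (Fin d) × ℝ}
    (hu : mink d u u = -1) (hu2 : 0 < u.2) : (x.2 - ‖x.1‖) * u.2 ≤ -mink d x u := by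
  have h1 : ‖u.1‖ ≤ u.2 := by
    unfold mink at hu
    rw [real_inner_self_eq_norm_sq] at hu
    exact abs_le_of_sq_le_sq' (by linarith) hu2.le |>.2
  have h2 := real_inner_le_norm x.1 u.1
  have h3 := mul_le_mul_of_nonneg_left h1 (norm_nonneg x.1)
  unfold mink
  linarith

theorem norm_fst_lt_snd {d : ℕ} {x : EuclideanSpace ℝ (Fin d) × ℝ}
    (hx : mink d x x = -1) (hx2 : 0 < x.2) : ‖x.1‖ < x.2 := by
  unfold mink at hx
  rw [real_inner_self_eq_norm_sq] at hx
  exact abs_lt_of_sq_lt_sq' (by linarith) hx2.le |>.2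

theorem isCompact_hyperboloid (d : ℕ) (R : ℝ) :
    IsCompact {u : EuclideanSpace ℝ (Fin d) × ℝ | (mink d u u = -1 ∧ 0 ≤ u.2) ∧ u.2 ≤ R} := by
  refine isCompact_of_isClosed_isBounded ?_ ?_
  · have hc : Continuous fun u : EuclideanSpace ℝ (Fin d) × ℝ => mink d u u := by
      unfold mink
      fun_prop
    exact ((isClosed_eq hc continuous_const).inter
      (isClosed_le continuous_const continuous_snd)).inter
      (isClosed_le continuous_snd continuous_const)
  · refine (isBounded_closedBall (x := 0) (r := R)).subset ?_
    rintro u ⟨⟨h1, h2⟩, h3⟩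
    rw [mem_closedBall_zero_iff, Prod.norm_def, Real.norm_eq_abs, abs_of_nonneg h2]
    refine max_le ?_ h3
    unfold mink at h1
    rw [real_inner_self_eq_norm_sq] at h1
    exact (abs_le_of_sq_le_sq' (by linarith) h2).2.trans h3

theorem IsHyperbolicSpace.properSpace {d : ℕ} (hX : IsHyperbolicSpace X d) : ProperSpace X := by
  obtain ⟨e, hinj, hrange, hdist⟩ := hX
  have he : ∀ x, mink d (e x) (e x) = -1 ∧ 0 < (e x).2 := fun x => by
    have := mem_range_self (f := e) x
    rwa [hrange] at this
  refine ⟨fun x r => ?_⟩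
  have hx := norm_fst_lt_snd (he x).1 (he x).2
  have hq : Continuous fun s : ℝ => Real.arcosh (max 1 s) :=
    Real.continuousOn_arcosh.comp_continuous (by fun_prop) fun s => mem_Ici.2 (le_max_left _ _)
  have hF : ∀ v, Continuous fun u : EuclideanSpace ℝ (Fin d) × ℝ => -mink d u v := fun v => by
    unfold mink
    fun_prop
  have hT := isCompact_hyperboloid d (Real.cosh r / ((e x).2 - ‖(e x).1‖))
  refine (isCompact_preimage_of_dist_eq hinj hq hF (fun a b => ?_) hT ?_).of_isClosed_subset
    isClosed_closedBall ?_
  · rw [← hdist, max_eq_right (Real.one_le_cosh _), Real.arcosh_cosh dist_nonneg]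
  · rintro u ⟨⟨h1, h2⟩, -⟩
    rw [hrange]
    refine ⟨h1, h2.lt_of_ne fun h0 => ?_⟩
    have : 0 ≤ inner ℝ u.1 u.1 := real_inner_self_nonneg
    unfold mink at h1
    rw [← h0] at h1
    linarith
  · intro y hy
    refine ⟨⟨(he y).1, (he y).2.le⟩, ?_⟩
    rw [le_div_iff₀ (by linarith), mul_comm]
    refine (mul_snd_le_neg_mink (he y).1 (he y).2).trans ?_
    rw [← hdist]
    refine Real.cosh_le_cosh.2 ?_
    rw [abs_of_nonneg dist_nonneg, dist_comm]
    exact (mem_closedBall.1 hy).trans (le_abs_self r)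

theorem IsHyperbolicSpace.geo {d : ℕ} (hd : 2 ≤ d) (hX : IsHyperbolicSpace X d) (hs : ¬ sph) :
    Geo X sph := by
  have := hX.properSpace
  obtain ⟨e, hinj, hrange, hdist⟩ := hX
  have he : ∀ x, mink d (e x) (e x) = -1 ∧ 0 < (e x).2 := fun x => by
    have := mem_range_self (f := e) x
    rwa [hrange] at this
  refine QuadricModel.geo (B := negMink d) (e := e) (C := Real.cosh) (S := Real.sinh) (ε := -1)
    { symm := fun u v => ?_
      injective := hinj
      self := fun x => by rw [negMink_apply, (he x).1, neg_neg]
      pair := fun x y => (hdist x y).symm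
      dist_le := fun h => absurd h hs
      sq := fun t => by nlinarith [Real.cosh_sq t]
      C_sub := fun s t => by rw [Real.cosh_sub]; ring
      C_add := fun s t => by rw [Real.cosh_add]; ring
      S_add := Real.sinh_add
      C_zero := Real.cosh_zero
      C_inj := fun s t h0 h1 _ _ h => Real.cosh_injOn h0 h1 h
      C_abs := Real.cosh_abs
      C_pos := fun _ => Real.cosh_pos
      S_ne := fun t h0 _ => (Real.sinh_pos_iff.2 h0).ne'
      definite := fun x v h1 h2 => ?_
      mem_range := fun v h1 h2 => ?_
      normal := fun x y => ?_ }
  · rw [negMink_apply, negMink_apply, mink, mink, real_inner_comm, mul_comm]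
  · rw [negMink_apply, neg_eq_zero] at h1 h2
    by_contra hv
    exact (mink_self_pos_of_orthogonal (he x).1 h1 hv).ne' h2
  · rw [negMink_apply, neg_eq_iff_eq_neg] at h1
    obtain ⟨x, hx⟩ := h2.resolve_left hs
    rw [hrange]
    refine ⟨h1, ?_⟩
    by_contra! hle
    rw [negMink_apply, mink, neg_sub] at hx
    have h3 := norm_fst_lt_snd (he x).1 (he x).2
    have h4 : ‖v.1‖ ≤ -v.2 := by
      unfold mink at h1
      rw [real_inner_self_eq_norm_sq] at h1
      exact (abs_le_of_sq_le_sq' (by linarith) (neg_nonneg.2 hle)).2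
    have h5 := (abs_le.1 (abs_real_inner_le_norm (e x).1 v.1)).1
    nlinarith [mul_le_mul h3.le h4 (norm_nonneg _) (he x).2.le]
  · obtain ⟨n, hn, h1, h2⟩ := exists_ne_zero_apply_eq_zero
      (by rw [Module.finrank_prod, finrank_euclideanSpace_fin, Module.finrank_self]; omega)
      (negMink d (e x)) (negMink d (e y))
    have hp := mink_self_pos_of_orthogonal (he x).1 (by rw [negMink_apply, neg_eq_zero] at h1; exact h1) hn
    have hp' := (Real.sqrt_pos.2 hp).ne'
    refine ⟨(√(mink d n n))⁻¹ • n, by simp [h1], by simp [h2], ?_⟩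
    rw [map_smul, map_smul, LinearMap.smul_apply, negMink_apply, smul_eq_mul, smul_eq_mul]
    field_simp
    rw [Real.sq_sqrt hp.le]

theorem geo_euclideanSpace {d : ℕ} (hd : 2 ≤ d) (hs : ¬ sph) :
    Geo (EuclideanSpace ℝ (Fin d)) sph where
  proper := inferInstance
  dist_le h := absurd h hs
  line x y h := by
    have hxy : dist x y ≠ 0 := dist_ne_zero.2 h
    refine ⟨fun t => AffineMap.lineMap x y (t / dist x y), by simp, by simp [hxy], fun s t _ => ?_⟩
    rw [dist_lineMap_lineMap, Real.dist_eq, ← sub_div, abs_div, abs_of_nonneg dist_nonneg,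
      div_mul_cancel₀ _ hxy]
  nonbranching w c z z' h h1 h2 h3 := by
    have e1 := (dist_add_dist_eq_iff.1 h1).sameRay_vsub
    have e2 := (dist_add_dist_eq_iff.1 h2).sameRay_vsub
    have hwc : c -ᵥ w ≠ 0 := vsub_ne_zero.2 h.symm
    obtain ⟨r, hr, e1⟩ := e1.exists_nonneg_left hwc
    obtain ⟨r', hr', e2⟩ := e2.exists_nonneg_left hwc
    rw [dist_comm c z, dist_comm c z', dist_eq_norm_vsub (EuclideanSpace ℝ (Fin d)) z c,
      dist_eq_norm_vsub (EuclideanSpace ℝ (Fin d)) z' c, ← e1, ← e2, norm_smul, norm_smul,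
      Real.norm_of_nonneg hr, Real.norm_of_nonneg hr'] at h3
    rw [mul_right_cancel₀ (norm_ne_zero_iff.2 hwc) h3] at e1
    exact vsub_left_cancel (e1.symm.trans e2)
  swap u v h := by
    have : Nonempty (AffineSubspace.perpBisector u v) :=
      AffineSubspace.perpBisector_nonempty.to_subtype
    refine ⟨(EuclideanGeometry.reflection (AffineSubspace.perpBisector u v)).toIsometryEquiv,
      EuclideanGeometry.reflection_involutive _, ?_, fun w hw => ?_⟩
    · have := EuclideanGeometry.reflection_orthogonal_vadd
        (AffineSubspace.midpoint_mem_perpBisector (V := EuclideanSpace ℝ (Fin d)) u v)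
        (v := u -ᵥ midpoint ℝ u v) (by
          rw [AffineSubspace.direction_perpBisector, left_vsub_midpoint]
          refine Submodule.le_orthogonal_orthogonal (Submodule.span ℝ {v -ᵥ u})
            (Submodule.smul_mem _ _ ?_)
          rw [← neg_vsub_eq_vsub_rev v u]
          exact Submodule.neg_mem _ (Submodule.mem_span_singleton_self _))
      rw [vsub_vadd, neg_vsub_eq_vsub_rev] at this
      refine this.trans ?_
      rw [midpoint_vsub_left, ← right_vsub_midpoint, vsub_vadd]
    · exact (EuclideanGeometry.reflection_eq_self_iff _).2
        (AffineSubspace.mem_perpBisector_iff_dist_eq.2 hw)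
  equidistant u v := by
    obtain ⟨n, hn, h⟩ := exists_ne_zero_map_eq_zero (innerₗ (EuclideanSpace ℝ (Fin d)) (v - u))
      (by rw [finrank_euclideanSpace_fin, Module.finrank_self]; omega)
    have h' : inner ℝ n (v - u) = 0 := (real_inner_comm _ _).trans h
    refine ⟨u + n, u - n, fun e => hn ?_, by simp, ?_⟩
    · have : (2 : ℝ) • n = 0 := by
        rw [two_smul, ← sub_neg_eq_add, ← add_sub_add_left_eq_sub n (-n) u, e]
        simp [sub_eq_add_neg]
      exact (smul_eq_zero.1 this).resolve_left two_ne_zero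
    · rw [dist_eq_norm, dist_eq_norm, ← sub_sub, sub_sub_eq_add_sub, add_sub_right_comm]
      exact norm_sub_eq_norm_add h'
  inversion x := by
    refine ⟨(AffineIsometryEquiv.pointReflection ℝ x).toIsometryEquiv,
      AffineIsometryEquiv.pointReflection_involutive _, AffineIsometryEquiv.pointReflection_self _,
      fun u _ => ?_⟩
    rw [dist_comm]
    exact AffineIsometryEquiv.dist_pointReflection_self_real x u

theorem Geo.of_isometryEquiv {E : Type*} [MetricSpace E] (G : Geo E sph) (f : X ≃ᵢ E) :
    Geo X sph where
  proper := by
    have := G.proper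
    refine ⟨fun x r => ?_⟩
    rw [← f.toHomeomorph.isCompact_image]
    change IsCompact (f '' _)
    rw [f.image_closedBall]
    exact isCompact_closedBall _ _
  dist_le h x y := by
    rw [← f.dist_eq]
    exact G.dist_le h _ _
  line x y h := by
    obtain ⟨γ, h0, h1, h2⟩ := G.line _ _ (f.injective.ne h)
    rw [f.dist_eq] at h1
    exact ⟨f.symm ∘ γ, by simp [h0], by simp [h1], fun s t hst => by
      rw [Function.comp_apply, Function.comp_apply, f.symm.dist_eq, h2 s t hst]⟩
  nonbranching w c z z' h h1 h2 h3 := by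
    refine f.injective (G.nonbranching (f w) (f c) _ _ (f.injective.ne h) ?_ ?_ ?_) <;>
    simpa only [Btw, f.dist_eq]
  swap u v h := by
    obtain ⟨s, h1, h2, h3⟩ := G.swap _ _ (f.injective.ne h)
    refine ⟨(f.trans s).trans f.symm, fun w => by simp [h1 (f w)], by simp [h2], fun w hw => ?_⟩
    simp [h3 (f w) (by rwa [f.dist_eq, f.dist_eq])]
  equidistant u v := by
    obtain ⟨p, q, h1, h2, h3⟩ := G.equidistant (f u) (f v)
    refine ⟨f.symm p, f.symm q, f.symm.injective.ne h1, ?_, ?_⟩ <;>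
    simpa only [← f.dist_eq, f.apply_symm_apply]
  inversion x := by
    obtain ⟨i, h1, h2, h3⟩ := G.inversion (f x)
    refine ⟨(f.trans i).trans f.symm, fun w => by simp [h1 (f w)], by simp [h2], fun u hu => ?_⟩
    have := h3 (f u) (by rwa [f.dist_eq])
    rw [f.dist_eq] at this
    rw [← this, ← f.dist_eq]
    simp

theorem IsSpaceForm.geo {d : ℕ} (hd : 2 ≤ d) (hX : IsSpaceForm X d) :
    Geo X (IsSphereSpace X d) := by
  by_cases hs : IsSphereSpace X d
  · exact hs.geo hd hs
  · rcases hX with h | ⟨⟨f⟩⟩ | h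
    · exact absurd h hs
    · exact (geo_euclideanSpace hd hs).of_isometryEquiv f
    · exact h.geo hd hs

/-- **Lemma 7.2.** Under hypothesis (****) and the supporting-spheres hypothesis of
Theorem 7, each of conditions (5) and (6) of Theorem 7 implies that both `K` and `L`
are `C¹` (smooth). -/
theorem lemma7_2
    (d : ℕ) (hd : 2 ≤ d)
    (X : Type*) [MetricSpace X] (hX : IsSpaceForm X d)
    (K L : Set X)
    (hKcl : IsClosed K) (hLcl : IsClosed L)
    (hKcv : GConvex K) (hLcv : GConvex L)
    (hKint : (interior K).Nonempty) (hLint : (interior L).Nonempty)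
    (hKpr : K ≠ univ) (hLpr : L ≠ univ)
    (hKhemi : IsSphereSpace X d → ∃ p : X, K ⊆ ball p (Real.pi / 2))
    (hLhemi : IsSphereSpace X d → ∃ p : X, L ⊆ ball p (Real.pi / 2))
    (hKsupp : SupportingSpheres d K) (hLsupp : SupportingSpheres d L) :
    (T7Cond5 d K L → SmoothBody K ∧ SmoothBody L) ∧
    (T7Cond6 d K L → SmoothBody K ∧ SmoothBody L) := by
  have G := hX.geo hd
  exact ⟨fun h =>
      ⟨G.smoothBody hKcl hKint hLcl hLint hLpr hKsupp hLsupp h.congruentEnds,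
        G.smoothBody hLcl hLint hKcl hKint hKpr hLsupp hKsupp h.congruentEnds.symm⟩,
    fun h =>
      ⟨G.smoothBody hKcl hKint hLcl hLint hLpr hKsupp hLsupp h.congruentEnds,
        G.smoothBody hLcl hLint hKcl hKint hKpr hLsupp hKsupp h.congruentEnds.symm⟩⟩

end BallChar
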